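/- arXiv:2301.04217 — 6 statements merged into one kernel-verified Lean document; each statement's English description precedes it below -/
import Mathlib

section
/- Let G be a finite simple graph with twin-width at most d (d a nonnegative integer), and let X be a nonempty subset of V(G). Then the number of distinct X-neighbourhoods in G, i.e. the number of distinct sets of the form N(v) ∩ X over all vertices v of G, is at most (d+2)·2^{d+1}·|X|. -/
/-- Two parts `P`, `Q` of a partition are joined by a red edge if they are distinct and the
pair `(P, Q)` is neither complete nor anticomplete in `G`. -/
def RedEdge {V : Type*} (G : SimpleGraph V) (P Q : Finset V) : Prop :=
  P ≠ Q ∧ (∃ u ∈ P, ∃ v ∈ Q, G.Adj u v) ∧ ∃ u ∈ P, ∃ v ∈ Q, ¬ G.Adj u v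

/-- The partition `Ps` has red degree at most `d`: every part is joined by a red edge to at most
`d` other parts. -/
def RedDegLE {V : Type*} (G : SimpleGraph V) (Ps : Finset (Finset V)) (d : ℕ) : Prop :=
  ∀ P ∈ Ps, {Q : Finset V | Q ∈ Ps ∧ RedEdge G P Q}.ncard ≤ d

/-- `G` has twin-width at most `d`: there is a contraction sequence
`Ps n, Ps (n-1), …, Ps 1` (with `n = |V(G)|`), starting from the partition of `V(G)` into
singletons, ending with the partition `{V(G)}`, each partition obtained from the previous one by
merging exactly two parts, in which every partition has red degree at most `d`. -/
def TwinWidthLE (V : Type*) [Fintype V] [DecidableEq V] (G : SimpleGraph V) (d : ℕ) : Prop :=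
  ∃ Ps : ℕ → Finset (Finset V),
    Ps (Fintype.card V) = Finset.univ.image (fun v => {v}) ∧
    Ps 1 = {Finset.univ} ∧
    (∀ i, 1 ≤ i → i < Fintype.card V →
      ∃ p ∈ Ps (i + 1), ∃ q ∈ Ps (i + 1), p ≠ q ∧
        Ps i = insert (p ∪ q) (((Ps (i + 1)).erase p).erase q)) ∧
    ∀ i, 1 ≤ i → i ≤ Fintype.card V → RedDegLE G (Ps i) d

open Classical in
/-- The trace of the neighbourhood of `v` on `X`. -/
noncomputable def trX {V : Type*} (G : SimpleGraph V) (X : Finset V) (v : V) : Finset V :=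
  X.filter (fun y => G.Adj v y)

open Classical in
theorem part_bound {V : Type*} [DecidableEq V] (G : SimpleGraph V) (d : ℕ) (Ps : Finset (Finset V))
    (X : Finset V) (hcov : ∀ v, ∃ P ∈ Ps, v ∈ P) (hred : RedDegLE G Ps d)
    (hX : ∀ P ∈ Ps, ∀ x ∈ P, ∀ y ∈ P, x ∈ X → y ∈ X → x = y)
    (Q : Finset V) (hQ : Q ∈ Ps) : (Q.image (trX G X)).card ≤ 2 ^ (d + 1) := by
  have h1 : (Ps.filter (fun R => RedEdge G Q R)).card ≤ d := by
    have := hred Q hQ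
    rw [← Set.ncard_coe_finset]
    simpa using this
  set T := (insert Q (Ps.filter (fun R => RedEdge G Q R))).biUnion (fun R => R ∩ X) with hT
  have hTc : T.card ≤ d + 1 := by
    have : T.card ≤ (insert Q (Ps.filter (fun R => RedEdge G Q R))).card * 1 := by
      apply Finset.card_biUnion_le_card_mul
      intro R hR
      have hR' : R ∈ Ps := by
        rcases Finset.mem_insert.1 hR with h | h
        · exact h ▸ hQ
        · exact (Finset.mem_filter.1 h).1
      rw [Finset.card_le_one]
      intro a ha b hb
      rw [Finset.mem_inter] at ha hb
      exact hX R hR' a ha.1 b hb.1 ha.2 hb.2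
    have h2 := Finset.card_insert_le Q (Ps.filter (fun R => RedEdge G Q R))
    omega
  calc (Q.image (trX G X)).card ≤ T.powerset.card := by
        apply Finset.card_le_card_of_injOn (fun S => S ∩ T)
        · intro S _
          simp
        · intro S hS S' hS' h
          simp only [Finset.coe_image, Set.mem_image, Finset.mem_coe] at hS hS'
          obtain ⟨u, hu, rfl⟩ := hS
          obtain ⟨w, hw, rfl⟩ := hS'
          ext y
          have hy := Finset.ext_iff.1 h y
          by_cases hyT : y ∈ T
          · simpa [hyT] using hy
          · simp only [trX, Finset.mem_filter]
            refine and_congr_right fun hyX => ?_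
            obtain ⟨R, hR, hyR⟩ := hcov y
            have hn : ¬ (R = Q ∨ RedEdge G Q R) := by
              intro hc
              apply hyT
              rw [hT, Finset.mem_biUnion]
              refine ⟨R, ?_, Finset.mem_inter.2 ⟨hyR, hyX⟩⟩
              simpa [hR] using hc
            rw [not_or] at hn
            by_contra hne
            apply hn.2
            refine ⟨fun e => hn.1 e.symm, ?_⟩
            by_cases ha : G.Adj u y
            · exact ⟨⟨u, hu, y, hyR, ha⟩, ⟨w, hw, y, hyR, by tauto⟩⟩
            · exact ⟨⟨w, hw, y, hyR, by tauto⟩, ⟨u, hu, y, hyR, ha⟩⟩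
    _ = 2 ^ T.card := Finset.card_powerset _
    _ ≤ 2 ^ (d + 1) := Nat.pow_le_pow_right (by norm_num) hTc

open Classical in
theorem exists_pair {V : Type*} [Fintype V] [DecidableEq V] (G : SimpleGraph V) (d : ℕ)
    (hG : TwinWidthLE V G d) (X : Finset V) (hX : 1 < X.card) :
    ∃ x ∈ X, ∃ x' ∈ X, x ≠ x' ∧
      ((Finset.univ.image (trX G X)).filter (fun S => ¬ (x ∈ S ↔ x' ∈ S))).card
        ≤ (d + 2) * 2 ^ (d + 1) := by
  obtain ⟨Ps, hn, h1, hstep, hred⟩ := hG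
  have hcov : ∀ j, ∀ i, 1 ≤ i → i + j = Fintype.card V → ∀ v, ∃ P ∈ Ps i, v ∈ P := by
    intro j
    induction j with
    | zero =>
      intro i _ hi v
      have : i = Fintype.card V := by omega
      subst this
      rw [hn]
      exact ⟨{v}, by simp, by simp⟩
    | succ j ih =>
      intro i hi hij v
      obtain ⟨P, hP, hv⟩ := ih (i + 1) (by omega) (by omega) v
      obtain ⟨p, hp, q, hq, hpq, he⟩ := hstep i hi (by omega)
      rw [he]
      by_cases h : P = p ∨ P = q
      · refine ⟨p ∪ q, Finset.mem_insert_self _ _, ?_⟩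
        rcases h with rfl | rfl <;> simp [hv]
      · rw [not_or] at h
        exact ⟨P, by simp [h.1, h.2, hP], hv⟩
  let good : ℕ → Prop := fun i => 1 ≤ i ∧
    ∀ P ∈ Ps i, ∀ x ∈ P, ∀ y ∈ P, x ∈ X → y ∈ X → x = y
  have hcard : X.card ≤ Fintype.card V := Finset.card_le_univ X
  have hgn : good (Fintype.card V) := by
    refine ⟨by omega, ?_⟩
    rw [hn]
    intro P hP x hx y hy _ _
    simp only [Finset.mem_image, Finset.mem_univ, true_and] at hP
    obtain ⟨v, rfl⟩ := hP
    rw [Finset.mem_singleton] at hx hy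
    rw [hx, hy]
  have hg1 : ¬ good 1 := by
    rintro ⟨_, h⟩
    rw [h1] at h
    obtain ⟨a, ha, b, hb, hab⟩ := Finset.one_lt_card.1 hX
    exact hab (h Finset.univ (by simp) a (by simp) b (by simp) ha hb)
  have hex : ∃ m, good m := ⟨_, hgn⟩
  obtain ⟨m, hm, hmin⟩ : ∃ m, good m ∧ ∀ k < m, ¬ good k :=
    ⟨Nat.find hex, Nat.find_spec hex, fun k hk => Nat.find_min hex hk⟩
  have hmn : m ≤ Fintype.card V := by
    by_contra hc
    exact hmin _ (by omega) hgn
  have hm1 : m ≠ 1 := fun h => hg1 (h ▸ hm)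
  obtain ⟨i, rfl⟩ : ∃ i, m = i + 1 := ⟨m - 1, by have := hm.1; omega⟩
  have hi1 : 1 ≤ i := by omega
  have hbad := hmin i (by omega)
  obtain ⟨p, hp, q, hq, hpq, he⟩ := hstep i hi1 (by omega)
  have hbad' : ∃ x ∈ X, ∃ x' ∈ X, x ≠ x' ∧ x ∈ p ∪ q ∧ x' ∈ p ∪ q := by
    by_contra hc
    apply hbad
    refine ⟨hi1, ?_⟩
    intro P hP x hx y hy hxX hyX
    by_contra hxy
    rw [he, Finset.mem_insert] at hP
    rcases hP with rfl | hP
    · exact hc ⟨x, hxX, y, hyX, hxy, hx, hy⟩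
    · exact hxy (hm.2 P (Finset.mem_of_mem_erase (Finset.mem_of_mem_erase hP)) x hx y hy hxX hyX)
  obtain ⟨x, hxX, x', hxX', hxx, hxp, hxp'⟩ := hbad'
  refine ⟨x, hxX, x', hxX', hxx, ?_⟩
  have hcov1 := hcov (Fintype.card V - (i + 1)) (i + 1) (by omega) (by omega)
  have hPi : p ∪ q ∈ Ps i := by rw [he]; exact Finset.mem_insert_self _ _
  have hr : ((Ps i).filter (fun R => RedEdge G (p ∪ q) R)).card ≤ d := by
    have := hred i hi1 (by omega) (p ∪ q) hPi
    rw [← Set.ncard_coe_finset]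
    simpa using this
  set A := insert p (insert q ((Ps i).filter (fun R => RedEdge G (p ∪ q) R))) with hA
  have hAc : A.card ≤ d + 2 := by
    have e1 := Finset.card_insert_le p (insert q ((Ps i).filter (fun R => RedEdge G (p ∪ q) R)))
    have e2 := Finset.card_insert_le q ((Ps i).filter (fun R => RedEdge G (p ∪ q) R))
    rw [hA]
    omega
  have hAm : ∀ Q ∈ A, Q ∈ Ps (i + 1) := by
    intro Q hQ
    rw [hA, Finset.mem_insert, Finset.mem_insert, Finset.mem_filter] at hQ
    rcases hQ with rfl | rfl | ⟨h, hre⟩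
    · exact hp
    · exact hq
    · rw [he, Finset.mem_insert] at h
      rcases h with h | h
      · exact absurd h.symm hre.1
      · exact Finset.mem_of_mem_erase (Finset.mem_of_mem_erase h)
  calc _ ≤ (A.biUnion (fun Q => Q.image (trX G X))).card := by
        apply Finset.card_le_card
        intro S hS
        rw [Finset.mem_filter, Finset.mem_image] at hS
        obtain ⟨⟨v, _, rfl⟩, hd⟩ := hS
        simp only [trX, Finset.mem_filter, hxX, hxX', true_and] at hd
        obtain ⟨Q, hQ, hv⟩ := hcov1 v
        rw [Finset.mem_biUnion]
        refine ⟨Q, ?_, Finset.mem_image_of_mem _ hv⟩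
        rw [hA, Finset.mem_insert, Finset.mem_insert, Finset.mem_filter]
        by_cases hQp : Q = p
        · exact Or.inl hQp
        by_cases hQq : Q = q
        · exact Or.inr (Or.inl hQq)
        by_cases hQu : p ∪ q = Q
        · skip
          exact absurd (hm.2 Q hQ x (hQu ▸ hxp) x' (hQu ▸ hxp') hxX hxX') hxx
        refine Or.inr (Or.inr ⟨by rw [he]; simp [hQp, hQq, hQ], hQu, ?_⟩)
        by_cases ha : G.Adj v x
        · exact ⟨⟨x, hxp, v, hv, ha.symm⟩, ⟨x', hxp', v, hv, fun h => hd (by simp [ha, h.symm])⟩⟩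
        · have hb : G.Adj v x' := by tauto
          exact ⟨⟨x', hxp', v, hv, hb.symm⟩, ⟨x, hxp, v, hv, fun h => ha h.symm⟩⟩
    _ ≤ A.card * 2 ^ (d + 1) := by
        apply Finset.card_biUnion_le_card_mul
        intro Q hQ
        exact part_bound G d (Ps (i + 1)) X hcov1 (hred _ (by omega) hmn) hm.2 Q (hAm Q hQ)
    _ ≤ (d + 2) * 2 ^ (d + 1) := Nat.mul_le_mul_right _ hAc

open Classical in
theorem trace_bound {V : Type*} [Fintype V] [DecidableEq V] (G : SimpleGraph V) (d : ℕ)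
    (hG : TwinWidthLE V G d) : ∀ (k : ℕ) (X : Finset V), X.card = k + 1 →
      (Finset.univ.image (trX G X)).card ≤ (d + 2) * 2 ^ (d + 1) * (k + 1) := by
  intro k
  induction k with
  | zero =>
    intro X hX
    have h : (Finset.univ.image (trX G X)).card ≤ X.powerset.card := by
      apply Finset.card_le_card
      intro S hS
      rw [Finset.mem_image] at hS
      obtain ⟨v, _, rfl⟩ := hS
      rw [Finset.mem_powerset]
      exact Finset.filter_subset _ _
    rw [Finset.card_powerset, hX] at h
    have : 1 ≤ 2 ^ (d + 1) := Nat.one_le_two_pow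
    have h4 : 2 * 1 ≤ (d + 2) * 2 ^ (d + 1) := Nat.mul_le_mul (by omega) this
    omega
  | succ k ih =>
    intro X hX
    obtain ⟨x, hx, x', hx', hne, hb⟩ := exists_pair G d hG X (by omega)
    have hi := ih (X.erase x) (by rw [Finset.card_erase_of_mem hx]; omega)
    have h2 : ((Finset.univ.image (trX G X)).filter (fun S => (x ∈ S ↔ x' ∈ S))).card
        ≤ (Finset.univ.image (trX G (X.erase x))).card := by
      apply Finset.card_le_card_of_injOn (fun S => S.erase x)
      · intro S hS
        simp only [Finset.coe_filter, Finset.mem_image, Set.mem_ofPred_eq] at hS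
        obtain ⟨⟨v, _, rfl⟩, _⟩ := hS
        simp only [Finset.coe_image, Set.mem_image, Finset.mem_coe]
        refine ⟨v, Finset.mem_univ _, ?_⟩
        ext y
        simp [trX, and_assoc]
      · intro S hS S' hS' h
        simp only [Finset.coe_filter, Set.mem_ofPred_eq] at hS hS'
        ext y
        by_cases hy : y = x
        · subst hy
          have := Finset.ext_iff.1 h x'
          simp only [Finset.mem_erase, ne_eq, hne.symm, not_false_eq_true, true_and] at this
          rw [hS.2, hS'.2, this]
        · have := Finset.ext_iff.1 h y
          simpa [hy] using this
    have h3 := Finset.card_filter_add_card_filter_not (s := Finset.univ.image (trX G X))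
      (fun S => (x ∈ S ↔ x' ∈ S))
    calc _ ≤ (d + 2) * 2 ^ (d + 1) * (k + 1) + (d + 2) * 2 ^ (d + 1) := by omega
      _ = _ := by ring

/-- Let `G` be a finite simple graph with twin-width at most `d` and let `X` be a nonempty set of
vertices. Then the number of distinct `X`-neighbourhoods `N(v) ∩ X` is at most
`(d+2) · 2^(d+1) · |X|`. -/
theorem neighbourhood_complexity_of_twin_width
    {V : Type*} [Fintype V] [DecidableEq V] (G : SimpleGraph V) (d : ℕ)
    (hG : TwinWidthLE V G d) (X : Finset V) (hX : X.Nonempty) :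
    {S : Set V | ∃ v : V, S = G.neighborSet v ∩ ↑X}.ncard ≤ (d + 2) * 2 ^ (d + 1) * X.card := by
  classical
  have hpos := hX.card_pos
  have h := trace_bound G d hG (X.card - 1) X (by omega)
  rw [Nat.sub_add_cancel hpos] at h
  refine le_trans ?_ h
  rw [← Set.ncard_coe_finset]
  have hs : {S : Set V | ∃ v : V, S = G.neighborSet v ∩ ↑X} =
      Set.image (fun T : Finset V => (T : Set V)) (↑(Finset.univ.image (trX G X)) : Set (Finset V)) := by
    ext S
    simp only [Set.mem_ofPred_eq, Finset.coe_image, Finset.coe_univ, Set.image_univ, Set.mem_image,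
      Set.mem_range, exists_exists_eq_and]
    refine exists_congr fun v => ?_
    have : ((trX G X v : Finset V) : Set V) = G.neighborSet v ∩ ↑X := by
      ext y
      simp [trX, and_comm]
    rw [this]
    exact eq_comm
  rw [hs]
  exact Set.ncard_image_le (Finset.finite_toSet _)
end

section
/- Let d be a nonnegative integer and let G be a finite simple graph on n vertices with twin-width at most d. Let X ⊆ V(G) with |X| = k ≥ 1, and suppose that any two distinct vertices of V(G) ∖ X have distinct X-neighbourhoods, i.e. for all distinct u, v ∈ V(G) ∖ X one has N(u) ∩ X ≠ N(v) ∩ X. Then n ≤ k·((d+2)·2^{d+1} + 1). -/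
open Classical in
/-- A part meets `S` in at most `2^(d+1)` vertices when parts have at most one element of `X`. -/
theorem part_card_le {V : Type*} [Fintype V] (G : SimpleGraph V) (d : ℕ)
    (Ps : Finset (Finset V)) (hcov : ∀ v, ∃ P ∈ Ps, v ∈ P) (hred : RedDegLE G Ps d)
    (X S : Finset V) (hX : ∀ P ∈ Ps, ∀ x ∈ X, ∀ y ∈ X, x ∈ P → y ∈ P → x = y)
    (hS : ∀ u ∈ S, ∀ v ∈ S, (∀ x ∈ X, (G.Adj u x ↔ G.Adj v x)) → u = v)
    (Q : Finset V) (hQ : Q ∈ Ps) : (S.filter (· ∈ Q)).card ≤ 2 ^ (d + 1) := by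
  set RN : Finset (Finset V) := Ps.filter (fun R => RedEdge G Q R) with hRN
  have hRNc : RN.card ≤ d := by
    have := hred Q hQ
    have e : {R : Finset V | R ∈ Ps ∧ RedEdge G Q R} = (RN : Set (Finset V)) := by
      ext R; simp [hRN]
    rwa [e, Set.ncard_coe_finset] at this
  set Y : Finset V := (insert Q RN).biUnion (fun R => X.filter (· ∈ R)) with hY
  have hYc : Y.card ≤ d + 1 := by
    have h1 : Y.card ≤ (insert Q RN).card * 1 := by
      apply Finset.card_biUnion_le_card_mul
      intro R hR
      have hRP : R ∈ Ps := by
        rcases Finset.mem_insert.1 hR with h | h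
        · exact h ▸ hQ
        · exact (Finset.mem_filter.1 h).1
      rw [Finset.card_le_one]
      intro a ha b hb
      rw [Finset.mem_filter] at ha hb
      exact hX R hRP a ha.1 b hb.1 ha.2 hb.2
    have := Finset.card_insert_le Q RN
    omega
  have h2 : (S.filter (· ∈ Q)).card ≤ Y.powerset.card := by
    apply Finset.card_le_card_of_injOn (fun u => Y.filter (fun x => G.Adj u x))
    · intro u _
      exact Finset.mem_coe.2 (Finset.mem_powerset.2 (Finset.filter_subset _ _))
    · intro u hu v hv huv
      simp only [Finset.mem_coe, Finset.mem_filter] at hu hv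
      apply hS u hu.1 v hv.1
      intro x hx
      by_cases hxY : x ∈ Y
      · have := congrArg (fun A => x ∈ A) huv
        simpa [hxY] using this
      · obtain ⟨R, hR, hxR⟩ := hcov x
        have hno : ¬ RedEdge G Q R := by
          intro h
          apply hxY
          rw [hY, Finset.mem_biUnion]
          exact ⟨R, Finset.mem_insert_of_mem (Finset.mem_filter.2 ⟨hR, h⟩),
            Finset.mem_filter.2 ⟨hx, hxR⟩⟩
        have hne : Q ≠ R := by
          rintro rfl
          apply hxY
          rw [hY, Finset.mem_biUnion]
          exact ⟨Q, Finset.mem_insert_self _ _, Finset.mem_filter.2 ⟨hx, hxR⟩⟩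
        constructor
        · intro h
          by_contra h'
          exact hno ⟨hne, ⟨u, hu.2, x, hxR, h⟩, ⟨v, hv.2, x, hxR, h'⟩⟩
        · intro h
          by_contra h'
          exact hno ⟨hne, ⟨v, hv.2, x, hxR, h⟩, ⟨u, hu.2, x, hxR, h'⟩⟩
  rw [Finset.card_powerset] at h2
  exact h2.trans (Nat.pow_le_pow_right (by norm_num) hYc)

open Classical in
/-- One contraction that first creates a part with two elements of `X`. -/
theorem step_card_le {V : Type*} [Fintype V] [DecidableEq V] (G : SimpleGraph V) (d : ℕ)
    (Ps Ps' : Finset (Finset V)) (hcov : ∀ v, ∃ P ∈ Ps, v ∈ P) (hred : RedDegLE G Ps d)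
    (hcov' : ∀ v, ∃ P ∈ Ps', v ∈ P) (hred' : RedDegLE G Ps' d)
    (p q : Finset V) (hp : p ∈ Ps) (hq : q ∈ Ps)
    (hPs' : Ps' = insert (p ∪ q) ((Ps.erase p).erase q))
    (X S : Finset V) (hX : ∀ P ∈ Ps, ∀ x ∈ X, ∀ y ∈ X, x ∈ P → y ∈ P → x = y)
    (hX' : ∃ P ∈ Ps', ∃ x ∈ X, ∃ y ∈ X, x ∈ P ∧ y ∈ P ∧ x ≠ y)
    (hS : ∀ u ∈ S, ∀ v ∈ S, (∀ x ∈ X, (G.Adj u x ↔ G.Adj v x)) → u = v) :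
    ∃ x ∈ X, ∃ S' ⊆ S, S.card ≤ S'.card + (d + 2) * 2 ^ (d + 1) ∧
      ∀ u ∈ S', ∀ v ∈ S', (∀ y ∈ X.erase x, (G.Adj u y ↔ G.Adj v y)) → u = v := by
  obtain ⟨P, hP, x, hx, y, hy, hxP, hyP, hxy⟩ := hX'
  have hin : ∀ R ∈ Ps', R ≠ p ∪ q → R ∈ Ps := by
    intro R hR hne
    rw [hPs', Finset.mem_insert] at hR
    rcases hR with h | h
    · exact absurd h hne
    · exact Finset.mem_of_mem_erase (Finset.mem_of_mem_erase h)
  have hPe : P = p ∪ q := by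
    by_contra hne
    exact hxy (hX P (hin P hP hne) x hx y hy hxP hyP)
  set RN : Finset (Finset V) := Ps'.filter (fun R => RedEdge G P R) with hRN
  have hRNc : RN.card ≤ d := by
    have := hred' P hP
    have e : {R : Finset V | R ∈ Ps' ∧ RedEdge G P R} = (RN : Set (Finset V)) := by
      ext R; simp [hRN]
    rwa [e, Set.ncard_coe_finset] at this
  set B : Finset V := (insert p (insert q RN)).biUnion (fun R => S.filter (· ∈ R)) with hB
  have hBc : B.card ≤ (d + 2) * 2 ^ (d + 1) := by
    have h1 : B.card ≤ (insert p (insert q RN)).card * 2 ^ (d + 1) := by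
      apply Finset.card_biUnion_le_card_mul
      intro R hR
      have hRP : R ∈ Ps := by
        rcases Finset.mem_insert.1 hR with h | h
        · exact h ▸ hp
        · rcases Finset.mem_insert.1 h with h | h
          · exact h ▸ hq
          · have h' := Finset.mem_filter.1 h
            exact hin R h'.1 (fun e => h'.2.1 (hPe.trans e.symm))
      convert part_card_le G d Ps hcov hred X S hX hS R hRP
    have h2 := Finset.card_insert_le p (insert q RN)
    have h3 := Finset.card_insert_le q RN
    exact h1.trans (Nat.mul_le_mul_right _ (by omega))
  have key : ∀ u ∈ S \ B, (G.Adj u x ↔ G.Adj u y) := by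
    intro u hu
    rw [Finset.mem_sdiff] at hu
    have hnB : ∀ R ∈ insert p (insert q RN), u ∉ R := by
      intro R hR huR
      apply hu.2
      rw [hB, Finset.mem_biUnion]
      exact ⟨R, hR, Finset.mem_filter.2 ⟨hu.1, huR⟩⟩
    obtain ⟨R, hR, huR⟩ := hcov' u
    have hno : ¬ RedEdge G P R := fun h =>
      hnB R (by simp [hRN, hR, h]) huR
    have hne : P ≠ R := by
      rintro rfl
      rw [hPe, Finset.mem_union] at huR
      rcases huR with h | h
      · exact hnB p (by simp) h
      · exact hnB q (by simp) h
    constructor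
    · intro h
      by_contra h'
      exact hno ⟨hne, ⟨x, hxP, u, huR, h.symm⟩, ⟨y, hyP, u, huR, fun h2 => h' h2.symm⟩⟩
    · intro h
      by_contra h'
      exact hno ⟨hne, ⟨y, hyP, u, huR, h.symm⟩, ⟨x, hxP, u, huR, fun h2 => h' h2.symm⟩⟩
  refine ⟨x, hx, S \ B, Finset.sdiff_subset, ?_, ?_⟩
  · have := Finset.card_le_card_sdiff_add_card (s := S) (t := B)
    omega
  · intro u hu v hv h
    apply hS u (Finset.mem_sdiff.1 hu).1 v (Finset.mem_sdiff.1 hv).1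
    intro z hz
    by_cases hzx : z = x
    · subst hzx
      rw [key u hu, key v hv]
      exact h y (Finset.mem_erase.2 ⟨hxy.symm, hy⟩)
    · exact h z (Finset.mem_erase.2 ⟨hzx, hz⟩)

/-- The main bound, by induction on `|X|`. -/
theorem main_card_le {V : Type*} [Fintype V] [DecidableEq V] (G : SimpleGraph V) (d : ℕ)
    (hG : TwinWidthLE V G d) (k : ℕ) : ∀ (X S : Finset V), X.card = k + 1 →
    (∀ u ∈ S, ∀ v ∈ S, (∀ x ∈ X, (G.Adj u x ↔ G.Adj v x)) → u = v) →
    S.card ≤ (k + 1) * ((d + 2) * 2 ^ (d + 1)) := by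
  classical
  induction k with
  | zero =>
    intro X S hX hS
    obtain ⟨x, rfl⟩ := Finset.card_eq_one.1 hX
    have h : S.card ≤ (Finset.univ : Finset Prop).card := by
      apply Finset.card_le_card_of_injOn (fun u => G.Adj u x)
      · intro u _; exact Finset.mem_coe.2 (Finset.mem_univ _)
      · intro u hu v hv huv
        apply hS u hu v hv
        intro y hy
        rw [Finset.mem_singleton.1 hy]
        exact iff_of_eq huv
    have h2 : (Finset.univ : Finset Prop).card = 2 := by simp
    have h3 : 1 ≤ 2 ^ (d + 1) := Nat.one_le_two_pow
    nlinarith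
  | succ k ih =>
    intro X S hXc hS
    obtain ⟨Ps, hn, h1, hstep, hred⟩ := hG
    have hlt : 1 < X.card := by omega
    have hn1 : 1 < Fintype.card V := lt_of_lt_of_le hlt (Finset.card_le_univ X)
    have hcov : ∀ j, j < Fintype.card V → ∀ v, ∃ P ∈ Ps (Fintype.card V - j), v ∈ P := by
      intro j
      induction j with
      | zero =>
        intro _ v
        exact ⟨{v}, by simp [hn], by simp⟩
      | succ j ihj =>
        intro hj v
        obtain ⟨p, hp, q, hq, hpq, he⟩ :=
          hstep (Fintype.card V - (j + 1)) (by omega) (by omega)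
        have e : Fintype.card V - (j + 1) + 1 = Fintype.card V - j := by omega
        rw [e] at hp hq he
        obtain ⟨P, hP, hv⟩ := ihj (by omega) v
        by_cases hPp : P = p
        · exact ⟨p ∪ q, by simp [he], by subst hPp; simp [hv]⟩
        · by_cases hPq : P = q
          · exact ⟨p ∪ q, by simp [he], by subst hPq; simp [hv]⟩
          · exact ⟨P, by simp [he, hPp, hPq, hP], hv⟩
    have hcov2 : ∀ i, 1 ≤ i → i ≤ Fintype.card V → ∀ v, ∃ P ∈ Ps i, v ∈ P := by
      intro i hi hi'
      have := hcov (Fintype.card V - i) (by omega)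
      rwa [show Fintype.card V - (Fintype.card V - i) = i by omega] at this
    let bad : ℕ → Prop := fun i => ∃ P ∈ Ps i, ∃ x ∈ X, ∃ y ∈ X, x ∈ P ∧ y ∈ P ∧ x ≠ y
    have hbad1 : bad 1 := by
      obtain ⟨x, hx, y, hy, hxy⟩ := Finset.one_lt_card.1 hlt
      exact ⟨Finset.univ, by simp [h1], x, hx, y, hy, by simp, by simp, hxy⟩
    have hbadn : ¬ bad (Fintype.card V) := by
      rintro ⟨P, hP, x, hx, y, hy, hxP, hyP, hxy⟩
      rw [hn, Finset.mem_image] at hP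
      obtain ⟨v, _, rfl⟩ := hP
      rw [Finset.mem_singleton] at hxP hyP
      exact hxy (hxP.trans hyP.symm)
    obtain ⟨i, hi1, hin, hbi, hbi'⟩ :
        ∃ i, 1 ≤ i ∧ i < Fintype.card V ∧ bad i ∧ ¬ bad (i + 1) := by
      by_contra hcon
      push Not at hcon
      have : ∀ j, 1 ≤ j → j ≤ Fintype.card V → bad j := by
        intro j hj
        induction j, hj using Nat.le_induction with
        | base => intro _; exact hbad1
        | succ j hj ihj => intro h; exact hcon j hj (by omega) (ihj (by omega))
      exact hbadn (this _ (by omega) le_rfl)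
    obtain ⟨p, hp, q, hq, -, he⟩ := hstep i hi1 hin
    obtain ⟨x, hx, S', -, hSc, hS'⟩ := step_card_le G d (Ps (i + 1)) (Ps i)
      (hcov2 _ (by omega) (by omega)) (hred _ (by omega) (by omega))
      (hcov2 _ hi1 hin.le) (hred _ hi1 hin.le) p q hp hq he X S
      (by
        intro P hP x hx y hy hxP hyP
        by_contra hne
        exact hbi' ⟨P, hP, x, hx, y, hy, hxP, hyP, hne⟩) hbi hS
    have := ih (X.erase x) S' (by rw [Finset.card_erase_of_mem hx]; omega) hS'
    calc S.card ≤ S'.card + (d + 2) * 2 ^ (d + 1) := hSc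
      _ ≤ (k + 1) * ((d + 2) * 2 ^ (d + 1)) + (d + 2) * 2 ^ (d + 1) := by omega
      _ = _ := by ring

/-- If `G` is an `n`-vertex graph of twin-width at most `d` and `X` is a set of `k ≥ 1` vertices
such that any two distinct vertices outside `X` have distinct `X`-neighbourhoods, then
`n ≤ k · ((d+2) · 2^(d+1) + 1)`. -/
theorem card_le_of_twin_width_of_distinct_neighbourhoods
    {V : Type*} [Fintype V] [DecidableEq V] (G : SimpleGraph V) (d k : ℕ)
    (hG : TwinWidthLE V G d) (X : Finset V) (hcard : X.card = k) (hk : 1 ≤ k)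
    (hdist : ∀ u v : V, u ∉ X → v ∉ X → u ≠ v →
      G.neighborSet u ∩ ↑X ≠ G.neighborSet v ∩ ↑X) :
    Fintype.card V ≤ k * ((d + 2) * 2 ^ (d + 1) + 1) := by
  obtain ⟨k, rfl⟩ : ∃ m, k = m + 1 := ⟨k - 1, by omega⟩
  have h := main_card_le G d hG k X Xᶜ hcard (by
    intro u hu v hv h
    by_contra hne
    apply hdist u v (Finset.mem_compl.1 hu) (Finset.mem_compl.1 hv) hne
    ext x
    simp only [Set.mem_inter_iff, SimpleGraph.mem_neighborSet, Finset.mem_coe]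
    constructor
    · rintro ⟨ha, hx⟩
      exact ⟨(h x hx).1 ha, hx⟩
    · rintro ⟨ha, hx⟩
      exact ⟨(h x hx).2 ha, hx⟩)
  have hc := Finset.card_add_card_compl X
  rw [Nat.mul_add]
  omega
end

section
/- Let d be a nonnegative integer and let G be a finite simple graph with twin-width at most d. Let X ⊆ V(G) with |X| ≥ 2, and suppose that any two distinct vertices of V(G) ∖ X have distinct X-neighbourhoods. For x ∈ X, let T_x be the set of unordered pairs {u,v} of distinct vertices of V(G) ∖ X satisfying N(u) ∩ (X ∖ {x}) = N(v) ∩ (X ∖ {x}). Then there exists a vertex x ∈ X such that |T_x| ≤ (d+2)·2^{d+1}. -/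
/-- `TxSet G X x` is the set of unordered pairs `{u, v}` of distinct vertices outside `X`
having the same `(X \ {x})`-neighbourhood. -/
def TxSet {V : Type*} [DecidableEq V] (G : SimpleGraph V) (X : Finset V) (x : V) :
    Set (Sym2 V) :=
  {p | ∃ u v : V, p = s(u, v) ∧ u ≠ v ∧ u ∉ X ∧ v ∉ X ∧
    G.neighborSet u ∩ ↑(X.erase x) = G.neighborSet v ∩ ↑(X.erase x)}

lemma aux_part {V : Type*} [Fintype V] [DecidableEq V] (G : SimpleGraph V) (d : ℕ)
    (Ps : Finset (Finset V)) (hcov : ∀ v, ∃ Q ∈ Ps, v ∈ Q) (hred : RedDegLE G Ps d)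
    (X : Finset V) (hd : ∀ u v : V, u ∉ X → v ∉ X → (∀ z ∈ X, (G.Adj u z ↔ G.Adj v z)) → u = v)
    (x y : V) (hx : x ∈ X) (hxy : x ≠ y) (P : Finset V) (hxP : x ∈ P)
    (hP : P ∈ Ps)
    (huniq : ∀ Q ∈ Ps, ∀ z ∈ Q, ∀ z' ∈ Q, z ∈ X → z' ∈ X → z ≠ y → z' ≠ y → z = z')
    (R : Finset V) (hR : R ∈ Ps) (hRP : R = P ∨ RedEdge G R P) (D : Finset V)
    (hD : ∀ w ∈ D, w ∈ R ∧ w ∉ X ∧ ¬ (G.Adj w x ↔ G.Adj w y)) :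
    D.card ≤ 2 ^ (d + 1) := by
  classical
  let F : Finset (Finset V) := insert R (Ps.filter (fun Q => RedEdge G R Q))
  have hF : F.card ≤ d + 1 := by
    refine (Finset.card_insert_le _ _).trans ?_
    have := hred R hR
    rw [show {Q : Finset V | Q ∈ Ps ∧ RedEdge G R Q} =
      ((Ps.filter (fun Q => RedEdge G R Q) : Finset (Finset V)) : Set (Finset V)) by ext; simp,
      Set.ncard_coe_finset] at this
    omega
  have hFP : ∀ Q ∈ F, Q ∈ Ps := by
    intro Q hQ
    rcases Finset.mem_insert.1 hQ with rfl | h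
    · exact hR
    · exact (Finset.mem_filter.1 h).1
  let S : Finset V := F.biUnion (fun Q => Q.filter (fun z => z ∈ X ∧ z ≠ y))
  have hS : S.card ≤ d + 1 := by
    refine (Finset.card_biUnion_le_card_mul _ _ 1 ?_).trans (by simpa using hF)
    intro Q hQ
    rw [Finset.card_le_one]
    intro a ha b hb
    simp only [Finset.mem_filter] at ha hb
    exact huniq Q (hFP Q hQ) a ha.1 b hb.1 ha.2.1 hb.2.1 ha.2.2 hb.2.2
  have hxS : x ∈ S := by
    refine Finset.mem_biUnion.2 ⟨P, ?_, by simp [hxP, hx, hxy]⟩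
    rcases hRP with h | h
    · simp [F, h]
    · simp [F, h, hP]
  have hinj : D.card ≤ S.powerset.card := by
    refine Finset.card_le_card_of_injOn (fun w => S.filter (fun z => G.Adj w z)) ?_ ?_
    · intro w _
      exact Finset.mem_coe.2 (Finset.mem_powerset.2 (Finset.filter_subset _ _))
    · intro w hw w' hw' h
      have hag : ∀ z ∈ S, (G.Adj w z ↔ G.Adj w' z) := by
        intro z hz
        have := Finset.ext_iff.1 h z
        simpa [hz] using this
      obtain ⟨hwR, hwX, hwd⟩ := hD w hw
      obtain ⟨hwR', hwX', hwd'⟩ := hD w' hw'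
      refine hd w w' hwX hwX' ?_
      intro z hz
      by_cases hzy : z = y
      · subst hzy
        have := hag x hxS
        tauto
      · obtain ⟨Q, hQ, hzQ⟩ := hcov z
        by_cases hQF : Q ∈ F
        · exact hag z (Finset.mem_biUnion.2 ⟨Q, hQF, by simp [hzQ, hz, hzy]⟩)
        · have h1 : Q ≠ R ∧ ¬ RedEdge G R Q := by
            simp only [F, Finset.mem_insert, Finset.mem_filter, not_or] at hQF
            exact ⟨hQF.1, fun h => hQF.2 ⟨hQ, h⟩⟩
          by_contra hne
          refine h1.2 ⟨h1.1.symm, ?_⟩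
          by_cases hz1 : G.Adj w z
          · exact ⟨⟨w, hwR, z, hzQ, hz1⟩, ⟨w', hwR', z, hzQ, by tauto⟩⟩
          · exact ⟨⟨w', hwR', z, hzQ, by tauto⟩, ⟨w, hwR, z, hzQ, hz1⟩⟩
  rw [Finset.card_powerset] at hinj
  exact hinj.trans (Nat.pow_le_pow_right (by norm_num) hS)

lemma aux_all {V : Type*} [Fintype V] [DecidableEq V] (G : SimpleGraph V) (d : ℕ)
    (Ps : Finset (Finset V)) (hcov : ∀ v, ∃ Q ∈ Ps, v ∈ Q) (hred : RedDegLE G Ps d)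
    (X : Finset V) (hd : ∀ u v : V, u ∉ X → v ∉ X → (∀ z ∈ X, (G.Adj u z ↔ G.Adj v z)) → u = v)
    (x y : V) (hx : x ∈ X) (hxy : x ≠ y) (P : Finset V) (hxP : x ∈ P) (hyP : y ∈ P)
    (hP : P ∈ Ps)
    (huniq : ∀ Q ∈ Ps, ∀ z ∈ Q, ∀ z' ∈ Q, z ∈ X → z' ∈ X → z ≠ y → z' ≠ y → z = z')
    (D : Finset V)
    (hD : ∀ w ∈ D, w ∉ X ∧ ¬ (G.Adj w x ↔ G.Adj w y)) :
    D.card ≤ (d + 1) * 2 ^ (d + 1) := by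
  classical
  let F : Finset (Finset V) := insert P (Ps.filter (fun Q => RedEdge G P Q))
  have hF : F.card ≤ d + 1 := by
    refine (Finset.card_insert_le _ _).trans ?_
    have := hred P hP
    rw [show {Q : Finset V | Q ∈ Ps ∧ RedEdge G P Q} =
      ((Ps.filter (fun Q => RedEdge G P Q) : Finset (Finset V)) : Set (Finset V)) by ext; simp,
      Set.ncard_coe_finset] at this
    omega
  have hsub : D ⊆ F.biUnion (fun R => D.filter (fun w => w ∈ R)) := by
    intro w hw
    obtain ⟨R, hR, hwR⟩ := hcov w
    refine Finset.mem_biUnion.2 ⟨R, ?_, by simp [hw, hwR]⟩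
    by_cases h : R = P
    · simp [F, h]
    · refine Finset.mem_insert_of_mem (Finset.mem_filter.2 ⟨hR, Ne.symm h, ?_⟩)
      have := (hD w hw).2
      by_cases h1 : G.Adj w x
      · exact ⟨⟨x, hxP, w, hwR, h1.symm⟩, ⟨y, hyP, w, hwR, fun h2 => by
          have := h2.symm
          tauto⟩⟩
      · have h2 : G.Adj w y := by tauto
        exact ⟨⟨y, hyP, w, hwR, h2.symm⟩, ⟨x, hxP, w, hwR, fun h3 => h1 h3.symm⟩⟩
  refine (Finset.card_le_card hsub).trans
    ((Finset.card_biUnion_le_card_mul _ _ (2 ^ (d + 1)) ?_).trans (Nat.mul_le_mul_right _ hF))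
  intro R hRF
  have hRPs : R ∈ Ps ∧ (R = P ∨ RedEdge G R P) := by
    rcases Finset.mem_insert.1 hRF with rfl | h
    · exact ⟨hP, Or.inl rfl⟩
    · obtain ⟨h1, h2, ⟨a, ha, b, hb, hab⟩, ⟨a', ha', b', hb', hab'⟩⟩ := Finset.mem_filter.1 h
      exact ⟨h1, Or.inr ⟨h2.symm, ⟨b, hb, a, ha, hab.symm⟩,
        ⟨b', hb', a', ha', fun h => hab' h.symm⟩⟩⟩
  refine aux_part G d Ps hcov hred X hd x y hx hxy P hxP hP huniq R hRPs.1 hRPs.2 _ ?_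
  intro w hw
  obtain ⟨hw1, hw2⟩ := Finset.mem_filter.1 hw
  exact ⟨hw2, hD w hw1⟩

lemma aux_exists {V : Type*} [Fintype V] [DecidableEq V] (G : SimpleGraph V) (d : ℕ)
    (hG : TwinWidthLE V G d) (X : Finset V) (hX : 2 ≤ X.card) :
    ∃ Ps : Finset (Finset V), (∀ v, ∃ Q ∈ Ps, v ∈ Q) ∧ RedDegLE G Ps d ∧
      ∃ x y P, x ∈ X ∧ y ∈ X ∧ x ≠ y ∧ x ∈ P ∧ y ∈ P ∧ P ∈ Ps ∧
        ∀ Q ∈ Ps, ∀ z ∈ Q, ∀ z' ∈ Q, z ∈ X → z' ∈ X → z ≠ y → z' ≠ y → z = z' := by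
  obtain ⟨Ps, hn, h1, hstep, hred⟩ := hG
  by_contra hcon
  have hcard : 2 ≤ Fintype.card V := hX.trans (Finset.card_le_univ X)
  have key : ∀ k, k < Fintype.card V →
      (∀ v, ∃ Q ∈ Ps (Fintype.card V - k), v ∈ Q) ∧
      ∀ Q ∈ Ps (Fintype.card V - k), ∀ z ∈ Q, ∀ z' ∈ Q, z ∈ X → z' ∈ X → z = z' := by
    intro k
    induction k with
    | zero =>
      intro _
      rw [Nat.sub_zero, hn]
      refine ⟨fun v => ⟨{v}, by simp, by simp⟩, ?_⟩
      intro Q hQ z hz z' hz' _ _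
      obtain ⟨v, _, rfl⟩ := Finset.mem_image.1 hQ
      rw [Finset.mem_singleton.1 hz, Finset.mem_singleton.1 hz']
    | succ k ih =>
      intro hk
      obtain ⟨hcov, hgood⟩ := ih (by omega)
      generalize hi : Fintype.card V - (k + 1) = i
      have hi' : Fintype.card V - k = i + 1 := by omega
      rw [hi'] at hcov hgood
      obtain ⟨p, hp, q, hq, hpq, hPs⟩ := hstep i (by omega) (by omega)
      have hcov' : ∀ v, ∃ Q ∈ Ps i, v ∈ Q := by
        intro v
        obtain ⟨Q, hQ, hv⟩ := hcov v
        rw [hPs]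
        by_cases h1 : Q = p
        · exact ⟨p ∪ q, by simp, by simp [← h1, hv]⟩
        · by_cases h2 : Q = q
          · exact ⟨p ∪ q, by simp, by simp [← h2, hv]⟩
          · exact ⟨Q, by simp [h1, h2, hQ], hv⟩
      refine ⟨hcov', ?_⟩
      by_contra hbad
      have hex : ∃ x ∈ p, ∃ y ∈ q, x ∈ X ∧ y ∈ X ∧ x ≠ y := by
        push Not at hbad
        obtain ⟨Q, hQ, z, hz, z', hz', hzX, hzX', hne⟩ := hbad
        rw [hPs] at hQ
        rcases Finset.mem_insert.1 hQ with rfl | hQ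
        · rcases Finset.mem_union.1 hz with hz | hz <;> rcases Finset.mem_union.1 hz' with hz' | hz'
          · exact absurd (hgood p hp z hz z' hz' hzX hzX') hne
          · exact ⟨z, hz, z', hz', hzX, hzX', hne⟩
          · exact ⟨z', hz', z, hz, hzX', hzX, hne.symm⟩
          · exact absurd (hgood q hq z hz z' hz' hzX hzX') hne
        · exact absurd (hgood Q (Finset.mem_of_mem_erase (Finset.mem_of_mem_erase hQ))
            z hz z' hz' hzX hzX') hne
      obtain ⟨x, hxp, y, hyq, hx, hy, hxy⟩ := hex
      refine hcon ⟨Ps i, hcov', hred i (by omega) (by omega), x, y, p ∪ q, hx, hy, hxy,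
        by simp [hxp], by simp [hyq], by simp [hPs], ?_⟩
      intro Q hQ z hz z' hz' hzX hzX' hzy hzy'
      rw [hPs] at hQ
      rcases Finset.mem_insert.1 hQ with rfl | hQ
      · have hmem : ∀ t ∈ p ∪ q, t ∈ X → t ≠ y → t = x := by
          intro t ht htX hty
          rcases Finset.mem_union.1 ht with ht | ht
          · exact hgood p hp t ht x hxp htX hx
          · exact absurd (hgood q hq t ht y hyq htX hy) hty
        rw [hmem z hz hzX hzy, hmem z' hz' hzX' hzy']
      · exact hgood Q (Finset.mem_of_mem_erase (Finset.mem_of_mem_erase hQ))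
            z hz z' hz' hzX hzX'
  obtain ⟨_, hlast⟩ := key (Fintype.card V - 1) (by omega)
  rw [show Fintype.card V - (Fintype.card V - 1) = 1 by omega, h1] at hlast
  obtain ⟨a, ha, b, hb, hab⟩ := Finset.one_lt_card.1 hX
  exact hab (hlast Finset.univ (by simp) a (by simp) b (by simp) ha hb)

/-- If `G` has twin-width at most `d`, `X` has at least two vertices, and any two distinct
vertices outside `X` have distinct `X`-neighbourhoods, then some `x ∈ X` satisfies
`|T_x| ≤ (d+2) · 2^(d+1)`. -/
theorem exists_vertex_with_few_twin_pairs
    {V : Type*} [Fintype V] [DecidableEq V] (G : SimpleGraph V) (d : ℕ)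
    (hG : TwinWidthLE V G d) (X : Finset V) (hX : 2 ≤ X.card)
    (hdist : ∀ u v : V, u ∉ X → v ∉ X → u ≠ v →
      G.neighborSet u ∩ ↑X ≠ G.neighborSet v ∩ ↑X) :
    ∃ x ∈ X, (TxSet G X x).ncard ≤ (d + 2) * 2 ^ (d + 1) := by
  classical
  have hd : ∀ u v : V, u ∉ X → v ∉ X → (∀ z ∈ X, (G.Adj u z ↔ G.Adj v z)) → u = v := by
    intro u v hu hv h
    by_contra hne
    refine hdist u v hu hv hne ?_
    ext z
    simp only [Set.mem_inter_iff, SimpleGraph.mem_neighborSet, Finset.mem_coe]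
    have := h z
    tauto
  obtain ⟨Ps, hcov, hred, x, y, P, hx, hy, hxy, hxP, hyP, hP, huniq⟩ := aux_exists G d hG X hX
  refine ⟨x, hx, ?_⟩
  let D : Finset V := Finset.univ.filter (fun w => w ∉ X ∧ ¬ (G.Adj w x ↔ G.Adj w y))
  have hDc : D.card ≤ (d + 1) * 2 ^ (d + 1) :=
    aux_all G d Ps hcov hred X hd x y hx hxy P hxP hyP hP huniq D
      (fun w hw => (Finset.mem_filter.1 hw).2)
  -- every pair of `T_x` has the following shape, whichever of its vertices is named first
  have hpair : ∀ e ∈ TxSet G X x, ∃ w ∈ D, ∃ v, e = s(w, v) ∧ v ∉ X ∧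
      ¬ (G.Adj w x ↔ G.Adj v x) ∧ ∀ z ∈ X, z ≠ x → (G.Adj w z ↔ G.Adj v z) := by
    rintro e ⟨u, v, rfl, huv, hu, hv, hN⟩
    have hag : ∀ z ∈ X, z ≠ x → (G.Adj u z ↔ G.Adj v z) := by
      intro z hz hzx
      have := Set.ext_iff.1 hN z
      simpa [hz, hzx] using this
    have hne : ¬ (G.Adj u x ↔ G.Adj v x) := by
      intro h
      refine huv (hd u v hu hv fun z hz => ?_)
      by_cases hzx : z = x
      · rw [hzx]
        exact h
      · exact hag z hz hzx
    have hagy := hag y hy hxy.symm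
    by_cases huD : (G.Adj u x ↔ G.Adj u y)
    · refine ⟨v, by simp only [D, Finset.mem_filter, Finset.mem_univ, true_and]; tauto, u,
        Sym2.eq_swap, hu, by tauto, fun z hz hzx => (hag z hz hzx).symm⟩
    · exact ⟨u, by simp only [D, Finset.mem_filter, Finset.mem_univ, true_and]; tauto, v,
        rfl, hv, hne, hag⟩
  haveI : Nonempty V := ⟨x⟩
  choose! f hfD g hg hgX hgx hgz using hpair
  have hle : (TxSet G X x).ncard ≤ (D : Set V).ncard := by
    refine Set.ncard_le_ncard_of_injOn f (fun e he => hfD e he) ?_ (Finset.finite_toSet D)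
    intro e he e' he' hee
    have : g e = g e' := by
      refine hd _ _ (hgX e he) (hgX e' he') fun z hz => ?_
      by_cases hzx : z = x
      · subst hzx
        have h1 := hgx e he
        have h2 := hgx e' he'
        rw [hee] at h1
        tauto
      · have h1 := hgz e he z hz hzx
        have h2 := hgz e' he' z hz hzx
        rw [hee] at h1
        tauto
    rw [hg e he, hg e' he', hee, this]
  rw [Set.ncard_coe_finset] at hle
  exact hle.trans (hDc.trans (Nat.mul_le_mul_right _ (by omega)))
end

section
/- Let G be a finite simple graph, let X ⊆ V(G), and suppose that any two distinct vertices of V(G) ∖ X have distinct X-neighbourhoods. Let d be a nonnegative integer and let 𝒫 be a partition of V(G) of red degree at most d such that every part of 𝒫 contains at most one vertex of X. Then every part P of 𝒫 satisfies |P ∖ X| ≤ 2^{d+1}. -/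
/-- `Ps` is a partition of the vertex set: parts are nonempty and every vertex lies in exactly
one part. -/
def IsPartitionOn {V : Type*} [Fintype V] (Ps : Finset (Finset V)) : Prop :=
  (∀ p ∈ Ps, p.Nonempty) ∧ ∀ v : V, ∃! p, p ∈ Ps ∧ v ∈ p

/-- If any two distinct vertices outside `X` have distinct `X`-neighbourhoods and `Ps` is a
partition of red degree at most `d` in which every part contains at most one vertex of `X`,
then every part `P` satisfies `|P \ X| ≤ 2^(d+1)`. -/
theorem part_minus_X_card_le
    {V : Type*} [Fintype V] [DecidableEq V] (G : SimpleGraph V) (X : Finset V)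
    (hdist : ∀ u v : V, u ∉ X → v ∉ X → u ≠ v →
      G.neighborSet u ∩ ↑X ≠ G.neighborSet v ∩ ↑X)
    (d : ℕ) (Ps : Finset (Finset V)) (hpart : IsPartitionOn Ps)
    (hred : RedDegLE G Ps d) (hone : ∀ p ∈ Ps, (p ∩ X).card ≤ 1) :
    ∀ p ∈ Ps, (p \ X).card ≤ 2 ^ (d + 1) := by
  classical
  intro p hp
  set R : Finset (Finset V) := insert p (Ps.filter (fun Q => RedEdge G p Q)) with hR
  have hRcard : R.card ≤ d + 1 := by
    have h := hred p hp
    have e : {Q : Finset V | Q ∈ Ps ∧ RedEdge G p Q}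
        = ((Ps.filter (fun Q => RedEdge G p Q) : Finset (Finset V)) : Set (Finset V)) := by
      ext Q; simp
    rw [e, Set.ncard_coe_finset] at h
    exact (Finset.card_insert_le _ _).trans (by omega)
  let f : V → Finset (Finset V) := fun v => R.filter (fun Q => ∃ x ∈ Q ∩ X, G.Adj v x)
  have key : ∀ u ∈ p, ∀ v ∈ p, f u = f v → ∀ x ∈ X, G.Adj u x → G.Adj v x := by
    intro u hu v hv huv x hx hux
    obtain ⟨Q, ⟨hQ, hxQ⟩, -⟩ := hpart.2 x
    by_cases hQR : Q ∈ R
    · have h1 : Q ∈ f u :=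
        Finset.mem_filter.2 ⟨hQR, x, Finset.mem_inter.2 ⟨hxQ, hx⟩, hux⟩
      rw [huv] at h1
      obtain ⟨-, y, hy, hvy⟩ := Finset.mem_filter.1 h1
      have hxy := Finset.card_le_one.1 (hone Q hQ) y hy x (Finset.mem_inter.2 ⟨hxQ, hx⟩)
      exact hxy ▸ hvy
    · by_contra hvx
      apply hQR
      by_cases hpQ : p = Q
      · rw [hR, hpQ]; exact Finset.mem_insert_self _ _
      · exact Finset.mem_insert_of_mem (Finset.mem_filter.2
          ⟨hQ, hpQ, ⟨u, hu, x, hxQ, hux⟩, ⟨v, hv, x, hxQ, hvx⟩⟩)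
  calc (p \ X).card ≤ R.powerset.card := by
        apply Finset.card_le_card_of_injOn f
        · intro v _
          exact Finset.mem_coe.2 (Finset.mem_powerset.2 (Finset.filter_subset _ _))
        · intro u hu v hv huv
          obtain ⟨hup, huX⟩ := Finset.mem_sdiff.1 (Finset.mem_coe.1 hu)
          obtain ⟨hvp, hvX⟩ := Finset.mem_sdiff.1 (Finset.mem_coe.1 hv)
          by_contra hne
          apply hdist u v huX hvX hne
          ext x
          constructor
          · rintro ⟨h1, h2⟩
            exact ⟨key u hup v hvp huv x h2 h1, h2⟩
          · rintro ⟨h1, h2⟩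
            exact ⟨key v hvp u hup huv.symm x h2 h1, h2⟩
    _ = 2 ^ R.card := Finset.card_powerset _
    _ ≤ 2 ^ (d + 1) := Nat.pow_le_pow_right (by norm_num) hRcard
end

section
/- There exists a constant c > 0 such that for every integer d ≥ 3 there exist a finite bipartite simple graph G of twin-width at most d and a nonempty set X ⊆ V(G) such that the number of distinct X-neighbourhoods in G (i.e., the number of distinct sets N(v) ∩ X over all vertices v of G) is at least c·d·2^d·|X|. -/
/-- The fibre of a labelling as a finset. -/
def fibOf {n : ℕ} (r : Fin n → Fin n) (p : Fin n) : Finset (Fin n) :=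
  Finset.univ.filter (fun a => r a = p)

theorem mem_fibOf {n : ℕ} (r : Fin n → Fin n) (p a : Fin n) : a ∈ fibOf r p ↔ r a = p := by
  simp [fibOf]

/-- Labels `p`, `q` have a non-homogeneous pair of fibres. -/
def NonHom {V : Type*} (G : SimpleGraph V) (r : V → V) (p q : V) : Prop :=
  (∃ u v, r u = p ∧ r v = q ∧ G.Adj u v) ∧ (∃ u v, r u = p ∧ r v = q ∧ ¬ G.Adj u v)

theorem tw_of_rep (n : ℕ) (hn : 0 < n) (G : SimpleGraph (Fin n)) (d : ℕ)
    (rep : ℕ → Fin n → Fin n) (τ : Fin n → Fin n)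
    (h0 : ∀ a, rep 0 a = a)
    (hge : ∀ t a, t < n → t ≤ (rep t a).val)
    (hfix : ∀ t (a : Fin n), t < n → t ≤ a.val → rep t a = a)
    (hτ : ∀ t : Fin n, t.val + 1 < n → t.val < (τ t).val)
    (hstep : ∀ t : Fin n, t.val + 1 < n → ∀ a, rep (t.val + 1) a =
      if rep t.val a = t then τ t else rep t.val a)
    (hred : ∀ t, t < n → d + 1 < n - t → ∀ p : Fin n, t ≤ p.val →
      {q : Fin n | t ≤ q.val ∧ NonHom G (rep t) p q}.ncard ≤ d) :
    TwinWidthLE (Fin n) G d := by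
  classical
  have hinj : ∀ t, t < n → ∀ p q : Fin n, t ≤ p.val → fibOf (rep t) p = fibOf (rep t) q → p = q := by
    intro t ht p q hp h
    have : p ∈ fibOf (rep t) q := by
      rw [← h, mem_fibOf]; exact hfix t p ht hp
    rw [mem_fibOf, hfix t p ht hp] at this
    exact this
  refine ⟨fun i => (Finset.univ.filter (fun p : Fin n => n - i ≤ p.val)).image
    (fibOf (rep (n - i))), ?_, ?_, ?_, ?_⟩
  · ext Q
    simp only [Fintype.card_fin, Nat.sub_self, Nat.zero_le, Finset.filter_true]
    have : fibOf (rep 0) = fun v : Fin n => {v} := by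
      funext v; ext a; rw [mem_fibOf, h0]; simp
    rw [this]
  · ext Q
    simp only [Finset.mem_image, Finset.mem_filter, Finset.mem_univ, true_and, Finset.mem_singleton]
    have key : ∀ p : Fin n, n - 1 ≤ p.val → fibOf (rep (n-1)) p = Finset.univ := by
      intro p hp
      ext a
      rw [mem_fibOf]
      have := hge (n-1) a (by omega)
      simp only [Finset.mem_univ, iff_true]
      apply Fin.ext
      have := (rep (n-1) a).isLt
      omega
    constructor
    · rintro ⟨p, hp, rfl⟩; exact key p hp
    · rintro rfl
      exact ⟨⟨n-1, by omega⟩, le_refl _, key _ (le_refl _)⟩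
  · intro i hi1 hi
    rw [Fintype.card_fin] at hi
    obtain ⟨t, ht⟩ : ∃ t : Fin n, t.val = n - (i+1) := ⟨⟨n - (i+1), by omega⟩, rfl⟩
    have ht1 : n - i = t.val + 1 := by omega
    have htn : t.val + 1 < n := by omega
    have hτt := hτ t htn
    beta_reduce
    rw [ht1, ← ht]
    refine ⟨fibOf (rep t) t, ?_, fibOf (rep t) (τ t), ?_, ?_, ?_⟩
    · exact Finset.mem_image_of_mem _ (by simp)
    · exact Finset.mem_image_of_mem _ (by simp; omega)
    · intro h
      have := hinj t t.isLt _ _ (le_refl _) h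
      rw [← this] at hτt
      omega
    · have hU : fibOf (rep t) t ∪ fibOf (rep t) (τ t) = fibOf (rep (t.val+1)) (τ t) := by
        ext a
        rw [Finset.mem_union, mem_fibOf, mem_fibOf, mem_fibOf, hstep t htn]
        split_ifs with h
        · simp [h]
        · simp [h]
      have hO : ∀ c : Fin n, t.val < c.val → c ≠ τ t →
          fibOf (rep (t.val+1)) c = fibOf (rep t) c := by
        intro c hc hne
        ext a
        rw [mem_fibOf, mem_fibOf, hstep t htn]
        split_ifs with h
        · rw [h]
          constructor
          · intro h'; exact absurd h'.symm hne
          · intro h'; rw [h'] at hc; omega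
        · rfl
      rw [hU]
      ext Q
      simp only [Finset.mem_image, Finset.mem_filter, Finset.mem_univ, true_and,
        Finset.mem_insert, Finset.mem_erase]
      constructor
      · rintro ⟨c, hc, rfl⟩
        by_cases hcτ : c = τ t
        · left; rw [hcτ]
        · right
          rw [hO c (by omega) hcτ]
          refine ⟨fun h => hcτ (hinj t t.isLt _ _ (by omega) h), fun h => ?_, c, by omega, rfl⟩
          have := hinj t t.isLt _ _ (by omega) h
          rw [this] at hc; omega
      · rintro (rfl | ⟨h1, h2, c, hc, rfl⟩)
        · exact ⟨τ t, by omega, rfl⟩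
        · have hct : c ≠ t := fun h => h2 (by rw [h])
          have hct' : c.val ≠ t.val := fun h => hct (Fin.ext h)
          have hcτ : c ≠ τ t := fun h => h1 (by rw [h])
          exact ⟨c, by omega, hO c (by omega) hcτ⟩
  · intro i hi1 hi
    rw [Fintype.card_fin] at hi
    intro P hP
    rw [Finset.mem_image] at hP
    obtain ⟨p, hp, rfl⟩ := hP
    simp only [Finset.mem_filter, Finset.mem_univ, true_and] at hp
    by_cases hd : d + 1 < i
    · refine le_trans ?_ (hred (n - i) (by omega) (by omega) p hp)
      refine le_trans (Set.ncard_le_ncard (t := fibOf (rep (n-i)) ''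
        {q : Fin n | n - i ≤ q.val ∧ NonHom G (rep (n-i)) p q}) ?_ (Set.toFinite _))
        (Set.ncard_image_le (Set.toFinite _))
      rintro Q ⟨hQ, hne, ⟨u, hu, v, hv, huv⟩, ⟨u', hu', v', hv', huv'⟩⟩
      simp only [Finset.mem_image, Finset.mem_filter, Finset.mem_univ, true_and] at hQ
      obtain ⟨q, hq, rfl⟩ := hQ
      rw [mem_fibOf] at hu hv hu' hv'
      exact ⟨q, ⟨hq, ⟨u, v, hu, hv, huv⟩, ⟨u', v', hu', hv', huv'⟩⟩, rfl⟩
    · set Ps := (Finset.univ.filter (fun p : Fin n => n - i ≤ p.val)).image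
        (fibOf (rep (n - i))) with hPs
      have hPm : fibOf (rep (n-i)) p ∈ Ps := Finset.mem_image_of_mem _ (by simp; omega)
      have hcard : Ps.card ≤ d + 1 := by
        refine le_trans Finset.card_image_le ?_
        have : (Finset.univ.filter (fun p : Fin n => n - i ≤ p.val)) ⊆
            Finset.univ.image (fun j : Fin i => (⟨n - i + j.val, by omega⟩ : Fin n)) := by
          intro a ha
          simp only [Finset.mem_filter, Finset.mem_univ, true_and] at ha
          simp only [Finset.mem_image, Finset.mem_univ, true_and]
          exact ⟨⟨a.val - (n - i), by omega⟩, Fin.ext (by simp; omega)⟩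
        refine le_trans (Finset.card_le_card this) (le_trans Finset.card_image_le ?_)
        simp; omega
      have hsub : {Q : Finset (Fin n) | Q ∈ Ps ∧ RedEdge G (fibOf (rep (n-i)) p) Q} ⊆
          ((Ps.erase (fibOf (rep (n-i)) p) : Finset _) : Set (Finset (Fin n))) := by
        rintro Q ⟨hQ, hne, _⟩
        simp only [Finset.coe_erase, Set.mem_sdiff, Finset.mem_coe, Set.mem_singleton_iff]
        exact ⟨hQ, fun h => hne h.symm⟩
      refine le_trans (Set.ncard_le_ncard hsub (Set.toFinite _)) ?_
      rw [Set.ncard_coe_finset, Finset.card_erase_of_mem hPm]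
      omega

theorem tw_fin (n N0 : ℕ) (hN : N0 < n) (G : SimpleGraph (Fin n)) (d : ℕ)
    (hd : n ≤ N0 + d + 1) (π : Fin n → Fin n)
    (hπ : ∀ a : Fin n, a.val < N0 → N0 ≤ (π a).val)
    (hred : ∀ t, t ≤ N0 → ∀ p : Fin n, t ≤ p.val →
      {q : Fin n | t ≤ q.val ∧ NonHom G (fun a => if a.val < t then π a else a) p q}.ncard ≤ d) :
    TwinWidthLE (Fin n) G d := by
  let last : Fin n := ⟨n - 1, by omega⟩
  let c : ℕ → Fin n → Fin n := fun t a => if a.val < t ∧ a.val < N0 then π a else a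
  have hcge : ∀ t, t ≤ N0 → ∀ a, t ≤ (c t a).val := by
    intro t ht a
    simp only [c]
    split_ifs with h
    · have := hπ a h.2; omega
    · omega
  have hlast : last.val = n - 1 := rfl
  refine tw_of_rep n (by omega) G d (fun t a => if (c t a).val < t then last else c t a)
    (fun t => if t.val < N0 then π t else last) ?_ ?_ ?_ ?_ ?_ ?_
  · intro a; simp [c]
  · intro t a ht
    split_ifs with h <;> omega
  · intro t a ht hta
    have : c t a = a := by simp only [c]; rw [if_neg]; omega
    rw [this, if_neg (by omega)]
  · intro t ht
    split_ifs with h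
    · have := hπ t h; omega
    · omega
  · intro t ht a
    by_cases h : t.val < N0
    · have h1 := hcge t.val (by omega) a
      have h2 := hcge (t.val+1) (by omega) a
      rw [if_neg (show ¬ (c (t.val + 1) a).val < t.val + 1 by omega),
        if_neg (show ¬ (c t.val a).val < t.val by omega), if_pos h]
      simp only [c]
      by_cases ha : a.val < t.val
      · have hne : π a ≠ t := by
          intro h'; have := hπ a (by omega); rw [h'] at this; omega
        rw [if_pos (show a.val < t.val + 1 ∧ a.val < N0 by omega),
          if_pos (show a.val < t.val ∧ a.val < N0 by omega), if_neg hne]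
      · by_cases ha' : a = t
        · subst ha'; simp [h]
        · have : a.val ≠ t.val := fun h => ha' (Fin.ext h)
          rw [if_neg (show ¬ (a.val < t.val + 1 ∧ a.val < N0) by omega),
            if_neg (show ¬ (a.val < t.val ∧ a.val < N0) by omega), if_neg ha']
    · have hc : c (t.val + 1) a = c t.val a := by
        simp only [c]
        by_cases ha : a.val < N0
        · rw [if_pos (by omega), if_pos (by omega)]
        · rw [if_neg (by omega), if_neg (by omega)]
      rw [hc, if_neg h]
      by_cases h1 : (c t.val a).val < t.val
      · rw [if_pos (by omega), if_pos h1]; simp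
      · rw [if_neg h1]
        by_cases h2 : c t.val a = t
        · rw [if_pos h2, if_pos (by rw [h2]; omega)]
        · have : (c t.val a).val ≠ t.val := fun h => h2 (Fin.ext h)
          rw [if_neg h2, if_neg (by omega)]
  · intro t ht htd p hp
    have htN : t ≤ N0 := by omega
    have : (fun a => if (c t a).val < t then last else c t a) =
        (fun a : Fin n => if a.val < t then π a else a) := by
      funext a
      have := hcge t htN a
      rw [if_neg (by omega)]
      simp only [c]
      by_cases ha : a.val < t
      · rw [if_pos (by omega), if_pos ha]
      · rw [if_neg (by omega), if_neg ha]
    rw [this]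
    exact hred t htN p hp

open Classical in
/-- The labelling that sends the elements of `U` to their parents. -/
noncomputable def lblOf {V : Type*} (U : Set V) (π : V → V) (a : V) : V :=
  if a ∈ U then π a else a

open Classical in
theorem tw_main {V : Type} [Fintype V] (G : SimpleGraph V) (d K : ℕ)
    (key : V → ℕ) (π : V → V)
    (hπ : ∀ v, key v < K → K ≤ key (π v))
    (hne : ∃ v, K ≤ key v)
    (hcard : (Finset.univ.filter (fun v => K ≤ key v)).card ≤ d + 1)
    (hred : ∀ U : Set V, (∀ u ∈ U, key u < K) → (∀ u ∈ U, ∀ v, v ∉ U → key u ≤ key v) →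
      ∀ p, p ∉ U → {q : V | q ∉ U ∧ NonHom G (lblOf U π) p q}.ncard ≤ d) :
    ∃ e : V ≃ Fin (Fintype.card V),
      TwinWidthLE (Fin (Fintype.card V)) (G.comap e.symm) d := by
  let e0 := Fintype.equivFin V
  let σ := Tuple.sort (key ∘ e0.symm)
  let e : V ≃ Fin (Fintype.card V) := e0.trans σ.symm
  have hmono : ∀ a b : Fin (Fintype.card V), a ≤ b → key (e.symm a) ≤ key (e.symm b) :=
    fun a b h => Tuple.monotone_sort (key ∘ e0.symm) h
  refine ⟨e, ?_⟩
  let N0 := (Finset.univ.filter (fun v => key v < K)).card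
  have hsum : N0 + (Finset.univ.filter (fun v => K ≤ key v)).card = Fintype.card V := by
    have := Finset.card_filter_add_card_filter_not (s := (Finset.univ : Finset V))
      (fun v => key v < K)
    simp only [not_lt] at this
    exact this
  have hpos : 0 < (Finset.univ.filter (fun v => K ≤ key v)).card := by
    rw [Finset.card_pos]
    obtain ⟨v, hv⟩ := hne
    exact ⟨v, by simp [hv]⟩
  have hlow : ∀ a : Fin (Fintype.card V), a.val < N0 ↔ key (e.symm a) < K := by
    intro a
    constructor
    · intro h
      by_contra hk
      have hsub : (Finset.univ.filter (fun v => key v < K)) ⊆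
          (Finset.Iio a).map e.symm.toEmbedding := by
        intro v hv
        simp only [Finset.mem_filter, Finset.mem_univ, true_and] at hv
        simp only [Finset.mem_map, Finset.mem_Iio, Equiv.coe_toEmbedding]
        refine ⟨e v, ?_, e.symm_apply_apply v⟩
        by_contra hle
        have := hmono a (e v) (not_lt.mp hle)
        rw [e.symm_apply_apply] at this
        omega
      have := Finset.card_le_card hsub
      rw [Finset.card_map, Fin.card_Iio] at this
      omega
    · intro h
      have hsub : (Finset.Iic a).map e.symm.toEmbedding ⊆
          (Finset.univ.filter (fun v => key v < K)) := by
        intro v hv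
        simp only [Finset.mem_map, Finset.mem_Iic, Equiv.coe_toEmbedding] at hv
        obtain ⟨b, hb, rfl⟩ := hv
        simp only [Finset.mem_filter, Finset.mem_univ, true_and]
        exact lt_of_le_of_lt (hmono b a hb) h
      have := Finset.card_le_card hsub
      rw [Finset.card_map, Fin.card_Iic] at this
      omega
  refine tw_fin _ N0 (by omega) _ d (by omega) (fun a => e (π (e.symm a))) ?_ ?_
  · intro a ha
    have h1 := hπ _ ((hlow a).1 ha)
    by_contra h2
    have := (hlow _).1 (not_le.mp h2)
    rw [e.symm_apply_apply] at this
    omega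
  · intro t ht p hp
    let U : Set V := {v | (e v).val < t}
    have h := hred U (fun u hu => by
        have := (hlow (e u)).1 (lt_of_lt_of_le hu ht)
        rwa [e.symm_apply_apply] at this)
      (fun u hu v hv => by
        have hu' : (e u).val < t := hu
        have hv' : ¬ (e v).val < t := hv
        have := hmono (e u) (e v) (Fin.le_def.2 (by omega))
        rwa [e.symm_apply_apply, e.symm_apply_apply] at this)
      (e.symm p) (by
        change ¬ (e (e.symm p)).val < t
        rw [e.apply_symm_apply]; omega)
    refine le_trans ?_ h
    have hr : ∀ a p, (if a.val < t then e (π (e.symm a)) else a) = p →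
        lblOf U π (e.symm a) = e.symm p := by
      intro a p h
      unfold lblOf
      have : e.symm a ∈ U ↔ a.val < t := by
        change (e (e.symm a)).val < t ↔ _
        rw [e.apply_symm_apply]
      simp only [this]
      rw [← h]
      split_ifs <;> simp
    rw [← Set.ncard_image_of_injective _ e.symm.injective]
    refine Set.ncard_le_ncard ?_ (Set.toFinite _)
    rintro _ ⟨q, ⟨hq, ⟨u, v, hu, hv, huv⟩, ⟨u', v', hu', hv', huv'⟩⟩, rfl⟩
    refine ⟨?_, ⟨e.symm u, e.symm v, hr _ _ hu, hr _ _ hv, huv⟩,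
      ⟨e.symm u', e.symm v', hr _ _ hu', hr _ _ hv', huv'⟩⟩
    change ¬ (e (e.symm q)).val < t
    rw [e.apply_symm_apply]; omega

/-- The vertices of the construction: `x`, `y` form the set `X`; `b` and `q` are targets for
contractions; `v` are the vertices with many neighbourhoods. -/
inductive Vx (M w k : ℕ) : Type
  | x (a : Fin (M + w)) : Vx M w k
  | y (j : Fin k) : Vx M w k
  | b : Vx M w k
  | q (j : Fin k) : Vx M w k
  | v (i : Fin M) (j : Fin k) (S : Finset (Fin w)) : Vx M w k

namespace Vx

variable {M w k : ℕ}

/-- An encoding of the vertices, used only for finiteness. -/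
def enc : Vx M w k →
    (Fin (M + w) ⊕ Fin k) ⊕ (Option (Fin k) ⊕ (Fin M × Fin k × Finset (Fin w)))
  | x a => Sum.inl (Sum.inl a)
  | y j => Sum.inl (Sum.inr j)
  | b => Sum.inr (Sum.inl none)
  | q j => Sum.inr (Sum.inl (some j))
  | v i j S => Sum.inr (Sum.inr (i, j, S))

theorem enc_injective : Function.Injective (enc : Vx M w k → _) := by
  intro u u' h
  cases u <;> cases u' <;> simp_all [enc]

noncomputable instance : Fintype (Vx M w k) := Fintype.ofInjective enc enc_injective

/-- Adjacency, directed from the side of `X` to the other side. -/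
def half : Vx M w k → Vx M w k → Prop
  | x a, v i _ S => a.val = i.val ∨ ∃ s ∈ S, a.val = i.val + 1 + s.val
  | y j, q j' => j = j'
  | y j, v _ j' _ => j = j'
  | _, _ => False

/-- The side of `X`. -/
def side : Vx M w k → Prop
  | x _ => True
  | y _ => True
  | b => True
  | q _ => False
  | v _ _ _ => False

theorem half_side {u u' : Vx M w k} (h : half u u') : side u ∧ ¬ side u' := by
  cases u <;> cases u' <;> simp_all [half, side]

/-- The graph. -/
def gr (M w k : ℕ) : SimpleGraph (Vx M w k) where
  Adj u u' := half u u' ∨ half u' u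
  symm := ⟨fun _ _ h => h.symm⟩
  loopless := ⟨fun u h => by
    have := h.elim half_side half_side
    exact this.2 this.1⟩

theorem gr_adj_side {u u' : Vx M w k} (h : (gr M w k).Adj u u') : side u ↔ ¬ side u' := by
  rcases h with h | h
  · have := half_side h; tauto
  · have := half_side h; tauto

theorem adj_of_side {u u' : Vx M w k} (h : side u) : (gr M w k).Adj u u' ↔ half u u' := by
  constructor
  · rintro (h' | h')
    · exact h'
    · exact absurd h (half_side h').2
  · exact Or.inl

/-- The key ordering the contractions. -/
def key : Vx M w k → ℕ
  | x a => 2 * a.val + 1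
  | v i _ _ => 2 * i.val
  | _ => 2 * (M + w)

/-- The target of each contraction. -/
def par : Vx M w k → Vx M w k
  | x _ => b
  | v _ j _ => q j
  | _ => b

section red
variable {U : Set (Vx M w k)}

theorem lblOf_side (hU : ∀ u ∈ U, key u < 2 * (M + w)) (u : Vx M w k) : side (lblOf U par u) ↔ side u := by
  unfold lblOf
  split_ifs with h
  · have := hU u h
    cases u <;> simp_all [side, par, key]
  · rfl

theorem lblOf_cases (hU : ∀ u ∈ U, key u < 2 * (M + w)) (u p : Vx M w k) (hp : lblOf U par u = p) :
    u = p ∨ (u ∈ U ∧ ((∃ a, u = x a ∧ p = b) ∨ ∃ i j S, u = v i j S ∧ p = q j)) := by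
  unfold lblOf at hp
  split_ifs at hp with h
  · right
    refine ⟨h, ?_⟩
    have := hU u h
    cases u <;> simp_all [par, key]
  · exact Or.inl hp

/-- Non-homogeneous pairs, first label on the `X` side. -/
theorem nonHom_cases (hU : ∀ u ∈ U, key u < 2 * (M + w))
    (hdown : ∀ u ∈ U, ∀ v, v ∉ U → key u ≤ key v)
    (p r : Vx M w k) (hp : side p) (hpU : p ∉ U) (hrU : r ∉ U)
    (h : NonHom (gr M w k) (lblOf U par) p r) :
    (∃ j, r = q j) ∧ (p = b ∨ ∃ a i j S, p = x a ∧ v i j S ∈ U ∧ i.val ≤ a.val ∧ a.val ≤ i.val + w) := by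
  obtain ⟨⟨u, u', hu, hu', hadj⟩, ⟨t, t', ht, ht', hnadj⟩⟩ := h
  have hsu : side u := by rw [← lblOf_side hU, hu]; exact hp
  have hst : side t := by rw [← lblOf_side hU, ht]; exact hp
  rw [adj_of_side hsu] at hadj
  rw [adj_of_side hst] at hnadj
  have hu1 := lblOf_cases hU _ _ hu
  have hu1' := lblOf_cases hU _ _ hu'
  have ht1 := lblOf_cases hU _ _ ht
  have ht1' := lblOf_cases hU _ _ ht'
  have hbound : ∀ (a : Fin (M+w)) (i : Fin M) (j : Fin k) (S : Finset (Fin w)),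
      half (x a : Vx M w k) (v i j S) → i.val ≤ a.val ∧ a.val ≤ i.val + w := by
    intro a i j S h
    rcases h with h | ⟨s, _, h⟩ <;> omega
  have hb : ∀ z : Vx M w k, ¬ half b z := by intro z; cases z <;> simp [half]
  cases r with
  | x a => 
    exfalso
    have : ¬ side u' := (half_side hadj).2
    rw [← lblOf_side hU, hu'] at this; exact this trivial
  | y a => 
    exfalso
    have : ¬ side u' := (half_side hadj).2
    rw [← lblOf_side hU, hu'] at this; exact this trivial
  | b => 
    exfalso
    have : ¬ side u' := (half_side hadj).2
    rw [← lblOf_side hU, hu'] at this; exact this trivial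
  | v i j S =>
    exfalso
    have e1 : u' = v i j S := by simpa using hu1'
    have e2 : t' = v i j S := by simpa using ht1'
    subst e1; subst e2
    cases p with
    | x a =>
      have e3 : u = x a := by simpa using hu1
      have e4 : t = x a := by simpa using ht1
      subst e3; subst e4; exact hnadj hadj
    | y a =>
      have e3 : u = y a := by simpa using hu1
      have e4 : t = y a := by simpa using ht1
      subst e3; subst e4; exact hnadj hadj
    | b =>
      rcases hu1 with rfl | ⟨hm, ⟨a, rfl, _⟩ | ⟨_, _, _, _, h⟩⟩
      · exact hb _ hadj
      · have h1 := hdown _ hm _ hrU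
        have h2 := hbound _ _ _ _ hadj
        simp only [key] at h1
        omega
      · cases h
    | q j => exact hp
    | v i j S => exact hp
  | q j =>
    refine ⟨⟨j, rfl⟩, ?_⟩
    cases p with
    | q j => exact hp.elim
    | v i j S => exact hp.elim
    | b => exact Or.inl rfl
    | y j' =>
      exfalso
      have e3 : u = y j' := by simpa using hu1
      have e4 : t = y j' := by simpa using ht1
      subst e3; subst e4
      have e5 : ∀ z : Vx M w k, (z = q j ∨ (z ∈ U ∧ ((∃ a, z = x a ∧ (q j : Vx M w k) = b) ∨
          ∃ i j' S, z = v i j' S ∧ (q j : Vx M w k) = q j'))) → (half (y j') z ↔ j' = j) := by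
        rintro z (rfl | ⟨_, ⟨a, _, h⟩ | ⟨i, j1, S, rfl, h⟩⟩)
        · rfl
        · cases h
        · cases h; rfl
      rw [e5 _ ht1'] at hnadj
      rw [e5 _ hu1'] at hadj
      exact hnadj hadj
    | x a =>
      right
      have e3 : u = x a := by simpa using hu1
      subst e3
      rcases hu1' with rfl | ⟨hm, ⟨a, _, h⟩ | ⟨i, j1, S, rfl, h⟩⟩
      · exact hadj.elim
      · cases h
      · exact ⟨a, i, j1, S, rfl, hm, hbound _ _ _ _ hadj⟩

theorem NonHom_symm {V : Type*} {G : SimpleGraph V} {r : V → V} {p q : V} (h : NonHom G r p q) :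
    NonHom G r q p := by
  obtain ⟨⟨u, u', hu, hu', hadj⟩, ⟨t, t', ht, ht', hnadj⟩⟩ := h
  exact ⟨⟨u', u, hu', hu, hadj.symm⟩, ⟨t', t, ht', ht, fun h => hnadj h.symm⟩⟩

theorem red_bound (hU : ∀ u ∈ U, key u < 2 * (M + w))
    (hdown : ∀ u ∈ U, ∀ v, v ∉ U → key u ≤ key v)
    (d : ℕ) (hk : k ≤ d) (hw : w + 2 ≤ d) (p : Vx M w k) (hpU : p ∉ U) :
    {r | r ∉ U ∧ NonHom (gr M w k) (lblOf U par) p r}.ncard ≤ d := by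
  classical
  by_cases hp : side p
  · have hsub : {r | r ∉ U ∧ NonHom (gr M w k) (lblOf U par) p r} ⊆
        ((Finset.univ.image (fun j : Fin k => (q j : Vx M w k)) : Finset _) : Set _) := by
      rintro r ⟨hr, h⟩
      obtain ⟨⟨j, rfl⟩, _⟩ := nonHom_cases hU hdown p r hp hpU hr h
      simp
    refine le_trans (Set.ncard_le_ncard hsub (Set.toFinite _)) ?_
    rw [Set.ncard_coe_finset]
    refine le_trans Finset.card_image_le ?_
    simpa using hk
  · have hside : ∀ r, NonHom (gr M w k) (lblOf U par) p r → side r := by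
      rintro r ⟨⟨u, u', hu, hu', hadj⟩, _⟩
      have := gr_adj_side hadj
      rw [← lblOf_side hU u, ← lblOf_side hU u', hu, hu'] at this
      tauto
    let A : Set ℕ := {a | ∃ (h : a < M + w), (x ⟨a, h⟩ : Vx M w k) ∉ U ∧ ∃ i j S, (v i j S : Vx M w k) ∈ U ∧
      i.val ≤ a ∧ a ≤ i.val + w}
    obtain ⟨a0, ha0⟩ : ∃ a0, ∀ a ∈ A, a0 ≤ a ∧ a ≤ a0 + w := by
      by_cases hA : A.Nonempty
      · refine ⟨sInf A, fun a ha => ⟨Nat.sInf_le ha, ?_⟩⟩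
        obtain ⟨h, hx, _⟩ := Nat.sInf_mem hA
        obtain ⟨_, _, i, j, S, hv, h1, h2⟩ := ha
        have := hdown _ hv _ hx
        simp only [key] at this
        omega
      · exact ⟨0, fun a ha => absurd ⟨a, ha⟩ hA⟩
    let f : ℕ → Vx M w k := fun a => if h : a < M + w then x ⟨a, h⟩ else b
    have hsub : {r | r ∉ U ∧ NonHom (gr M w k) (lblOf U par) p r} ⊆
        ((insert b ((Finset.Icc a0 (a0 + w)).image f) : Finset _) : Set _) := by
      rintro r ⟨hr, h⟩
      obtain ⟨_, rfl | ⟨a, i, j, S, rfl, hm, h1, h2⟩⟩ :=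
        nonHom_cases hU hdown r p (hside r h) hr hpU (NonHom_symm h)
      · simp
      · have haA : a.val ∈ A := ⟨a.isLt, hr, i, j, S, hm, h1, h2⟩
        rw [Finset.mem_coe, Finset.mem_insert, Finset.mem_image]
        right
        refine ⟨a.val, Finset.mem_Icc.2 (ha0 _ haA), ?_⟩
        simp [f]
    refine le_trans (Set.ncard_le_ncard hsub (Set.toFinite _)) ?_
    rw [Set.ncard_coe_finset]
    refine le_trans (Finset.card_insert_le _ _) ?_
    have := Finset.card_image_le (s := Finset.Icc a0 (a0 + w)) (f := f)
    rw [Nat.card_Icc] at this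
    omega

end red

theorem high_card (d : ℕ) (hk : 2 * k ≤ d) [DecidablePred fun z : Vx M w k => 2 * (M + w) ≤ key z] :
    (Finset.univ.filter (fun z : Vx M w k => 2 * (M + w) ≤ key z)).card ≤ d + 1 := by
  classical
  have hsub : (Finset.univ.filter (fun z : Vx M w k => 2 * (M + w) ≤ key z)) ⊆
      insert b (Finset.univ.image (fun j : Fin k => (q j : Vx M w k)) ∪
        Finset.univ.image (fun j : Fin k => (y j : Vx M w k))) := by
    intro z hz
    simp only [Finset.mem_filter, Finset.mem_univ, true_and] at hz
    cases z with
    | x a => simp only [key] at hz; omega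
    | v i j S => simp only [key] at hz; omega
    | _ => simp
  refine le_trans (Finset.card_le_card hsub) (le_trans (Finset.card_insert_le _ _) ?_)
  have h1 := Finset.card_union_le (Finset.univ.image (fun j : Fin k => (q j : Vx M w k)))
        (Finset.univ.image (fun j : Fin k => (y j : Vx M w k)))
  have h2 := Finset.card_image_le (s := Finset.univ) (f := (fun j : Fin k => (q j : Vx M w k)))
  have h3 := Finset.card_image_le (s := Finset.univ) (f := (fun j : Fin k => (y j : Vx M w k)))
  simp only [Finset.card_univ, Fintype.card_fin] at h2 h3
  omega

theorem exists_equiv (d : ℕ) (hk : 2 * k ≤ d) (hw : w + 2 ≤ d) :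
    ∃ e : Vx M w k ≃ Fin (Fintype.card (Vx M w k)),
      TwinWidthLE (Fin (Fintype.card (Vx M w k))) ((gr M w k).comap e.symm) d := by
  refine tw_main (gr M w k) d (2 * (M + w)) key par ?_ ⟨b, le_refl _⟩ (high_card d hk) ?_
  · intro z _
    cases z <;> exact le_refl _
  · intro U hU hdown p hp
    exact red_bound hU hdown d (by omega) hw p hp

/-- The map from `X`-indices to vertices. -/
def xs : Fin (M + w) ⊕ Fin k → Vx M w k := Sum.elim x y

theorem v_inj (i i' : Fin M) (j j' : Fin k) (S S' : Finset (Fin w))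
    (h : ∀ z : Fin (M + w) ⊕ Fin k, (gr M w k).Adj (v i j S) (xs z) ↔ (gr M w k).Adj (v i' j' S') (xs z)) :
    i = i' ∧ j = j' ∧ S = S' := by
  have hx : ∀ a, half (x a : Vx M w k) (v i j S) ↔ half (x a : Vx M w k) (v i' j' S') := by
    intro a
    have := h (Sum.inl a)
    rw [SimpleGraph.adj_comm, SimpleGraph.adj_comm _ (v i' j' S')] at this
    rwa [adj_of_side (u := xs (Sum.inl a)) trivial, adj_of_side (u := xs (Sum.inl a)) trivial] at this
  have hy : half (y j : Vx M w k) (v i j S) ↔ half (y j : Vx M w k) (v i' j' S') := by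
    have := h (Sum.inr j)
    rw [SimpleGraph.adj_comm, SimpleGraph.adj_comm _ (v i' j' S')] at this
    rwa [adj_of_side (u := xs (Sum.inr j)) trivial, adj_of_side (u := xs (Sum.inr j)) trivial] at this
  have hj : j = j' := hy.1 rfl
  have hi : i.val = i'.val := by
    have h1 := (hx ⟨i.val, by omega⟩).1 (Or.inl rfl)
    have h2 := (hx ⟨i'.val, by omega⟩).2 (Or.inl rfl)
    rcases h1 with h1 | ⟨s, _, h1⟩ <;> rcases h2 with h2 | ⟨s', _, h2⟩ <;> simp at h1 h2 <;> omega
  have hi' : i = i' := Fin.ext hi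
  refine ⟨hi', hj, ?_⟩
  subst hi'
  have hS : ∀ (T : Finset (Fin w)) (j : Fin k) (s : Fin w),
      half (x ⟨i.val + 1 + s.val, by omega⟩ : Vx M w k) (v i j T) ↔ s ∈ T := by
    intro T j s
    constructor
    · rintro (h | ⟨s', hs', h⟩)
      · simp at h; omega
      · have : s = s' := Fin.ext (by simp at h; omega)
        rwa [this]
    · intro hs
      exact Or.inr ⟨s, hs, rfl⟩
  ext s
  rw [← hS S j s, ← hS S' j' s, hx]

end Vx

/-- There is a constant `c > 0` such that for every `d ≥ 3` there are a finite bipartite graph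
`G` of twin-width at most `d` and a nonempty vertex subset `X` with at least `c · d · 2^d · |X|`
distinct `X`-neighbourhoods. -/
theorem lower_bound_neighbourhood_complexity :
    ∃ c : ℝ, 0 < c ∧ ∀ d : ℕ, 3 ≤ d →
      ∃ (n : ℕ) (G : SimpleGraph (Fin n)) (S : Set (Fin n)) (X : Finset (Fin n)),
        (∀ u v : Fin n, G.Adj u v → (u ∈ S ↔ v ∉ S)) ∧
        TwinWidthLE (Fin n) G d ∧ X.Nonempty ∧
        c * (d : ℝ) * 2 ^ d * (X.card : ℝ) ≤
          ({N : Set (Fin n) | ∃ v : Fin n, N = G.neighborSet v ∩ ↑X}.ncard : ℝ) := by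
  refine ⟨1 / 36, by norm_num, fun d hd => ?_⟩
  obtain ⟨w, rfl⟩ : ∃ w, d = w + 2 := ⟨d - 2, by omega⟩
  obtain ⟨k, hk⟩ : ∃ k, k = (w + 2) / 2 := ⟨_, rfl⟩
  obtain ⟨M, hM⟩ : ∃ M, M = w + 2 := ⟨_, rfl⟩
  obtain ⟨e, he⟩ := Vx.exists_equiv (M := M) (w := w) (k := k) (w + 2) (by omega) (le_refl _)
  let X : Finset (Fin (Fintype.card (Vx M w k))) :=
    Finset.univ.image (fun z : Fin (M + w) ⊕ Fin k => e (Vx.xs z))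
  have hXm : ∀ z : Fin (M + w) ⊕ Fin k, e (Vx.xs z) ∈ X := fun z =>
    Finset.mem_image_of_mem _ (Finset.mem_univ z)
  refine ⟨_, (Vx.gr M w k).comap e.symm, {a | Vx.side (e.symm a)}, X, ?_, he, ?_, ?_⟩
  · intro u v h
    exact Vx.gr_adj_side h
  · exact ⟨_, hXm (Sum.inl ⟨0, by omega⟩)⟩
  · have hXc : X.card ≤ 3 * (w + 2) := by
      refine le_trans Finset.card_image_le ?_
      simp only [Finset.card_univ, Fintype.card_sum, Fintype.card_fin]
      omega
    let F : Fin M × Fin k × Finset (Fin w) → Set (Fin (Fintype.card (Vx M w k))) := fun z =>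
      ((Vx.gr M w k).comap e.symm).neighborSet (e (Vx.v z.1 z.2.1 z.2.2)) ∩ ↑X
    have hF : Function.Injective F := by
      rintro ⟨i, j, S⟩ ⟨i', j', S'⟩ h
      have := Vx.v_inj i i' j j' S S' (fun z => by
        have h1 : e (Vx.xs z) ∈ F (i, j, S) ↔ e (Vx.xs z) ∈ F (i', j', S') := by rw [h]
        simpa [F, hXm z] using h1)
      obtain ⟨rfl, rfl, rfl⟩ := this
      rfl
    have hcount : M * (k * 2 ^ w) ≤ {N : Set (Fin (Fintype.card (Vx M w k))) |
        ∃ v, N = ((Vx.gr M w k).comap e.symm).neighborSet v ∩ ↑X}.ncard := by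
      have h1 : (Set.range F).ncard = M * (k * 2 ^ w) := by
        rw [← Set.image_univ, Set.ncard_image_of_injective _ hF, Set.ncard_univ]
        simp
      rw [← h1]
      refine Set.ncard_le_ncard ?_ (Set.toFinite _)
      rintro _ ⟨z, rfl⟩
      exact ⟨_, rfl⟩
    refine le_trans ?_ (Nat.cast_le.2 hcount)
    have hk3 : ((w : ℝ) + 2) ≤ 3 * k := by
      have : w + 2 ≤ 3 * k := by omega
      exact_mod_cast this
    have hXr : (X.card : ℝ) ≤ 3 * ((w : ℝ) + 2) := by exact_mod_cast hXc
    subst hM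
    push_cast
    have hpos : (0 : ℝ) < ((w : ℝ) + 2) * 2 ^ w := by positivity
    calc 1 / 36 * ((w : ℝ) + 2) * 2 ^ (w + 2) * (X.card : ℝ)
        = 1 / 9 * (((w : ℝ) + 2) * 2 ^ w) * (X.card : ℝ) := by ring
      _ ≤ 1 / 9 * (((w : ℝ) + 2) * 2 ^ w) * (9 * k) := by
          gcongr
          linarith
      _ = ((w : ℝ) + 2) * (k * 2 ^ w) := by ring
end

section
/- Let k, A, B, C be positive integers with k ≥ A + B + C. Then the graph G(k,A,B,C) has at least A·B·(k − A − B − C)·2^C vertices outside X, and consequently (since any two distinct vertices outside X have distinct X-neighbourhoods) the number of distinct X-neighbourhoods in G(k,A,B,C) is at least A·B·(k − A − B − C)·2^C. -/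
/-- The index set `{1, …, k}` for the vertices `x_1, …, x_k` of `X`. -/
abbrev Idx (k : ℕ) := {m : ℕ // m ∈ Finset.Icc 1 k}

/-- A quadruple `(i, j, t, Y)` is valid when `1 ≤ i ≤ j ≤ i + A - 1`, `j + 2 ≤ t ≤ j + 1 + B`,
`t ≤ k - C` and `Y ⊆ {t + 1, …, t + C}`. -/
def ValidQuad (k A B C : ℕ) (q : Idx k × Idx k × Idx k × Finset (Idx k)) : Prop :=
  (q.1 : ℕ) ≤ (q.2.1 : ℕ) ∧ (q.2.1 : ℕ) + 1 ≤ (q.1 : ℕ) + A ∧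
  (q.2.1 : ℕ) + 2 ≤ (q.2.2.1 : ℕ) ∧ (q.2.2.1 : ℕ) ≤ (q.2.1 : ℕ) + 1 + B ∧
  (q.2.2.1 : ℕ) + C ≤ k ∧
  ∀ y ∈ q.2.2.2, (q.2.2.1 : ℕ) + 1 ≤ (y : ℕ) ∧ (y : ℕ) ≤ (q.2.2.1 : ℕ) + C

instance (k A B C : ℕ) : DecidablePred (ValidQuad k A B C) := fun _ => by
  unfold ValidQuad; infer_instance

/-- The valid quadruples `(i, j, t, Y)`, indexing the vertices `v_{(i,j,t,Y)}` outside `X`. -/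
abbrev Quad (k A B C : ℕ) :=
  {q : Idx k × Idx k × Idx k × Finset (Idx k) // ValidQuad k A B C q}

/-- The vertex set of `G(k,A,B,C)`: the vertices `x_m` for `m ∈ {1, …, k}` (left) together with
the vertices `v_{(i,j,t,Y)}` (right). -/
abbrev GV (k A B C : ℕ) := Idx k ⊕ Quad k A B C

/-- `v_{(i,j,t,Y)}` is adjacent exactly to `{x_i, …, x_j} ∪ {x_t} ∪ {x_m : m ∈ Y}`. -/
def gAdjRel (k A B C : ℕ) : GV k A B C → GV k A B C → Prop
  | Sum.inl m, Sum.inr q =>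
      ((q.1.1 : ℕ) ≤ (m : ℕ) ∧ (m : ℕ) ≤ (q.1.2.1 : ℕ)) ∨ m = q.1.2.2.1 ∨ m ∈ q.1.2.2.2
  | _, _ => False

/-- The bipartite graph `G(k,A,B,C)`. -/
def GkABC (k A B C : ℕ) : SimpleGraph (GV k A B C) := SimpleGraph.fromRel (gAdjRel k A B C)

/-- The vertex subset `X = {x_1, …, x_k}` of `G(k,A,B,C)`. -/
def Xset (k A B C : ℕ) : Set (GV k A B C) := Set.range Sum.inl

/-- Membership of `x_m` in the neighbourhood of `v_q`, on raw quadruples. -/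
def memN (k A B C : ℕ) (q : Quad k A B C) (m : Idx k) : Prop :=
  ((q.1.1 : ℕ) ≤ (m : ℕ) ∧ (m : ℕ) ≤ (q.1.2.1 : ℕ)) ∨ m = q.1.2.2.1 ∨ m ∈ q.1.2.2.2

theorem memN_iff (k A B C : ℕ) (q : Quad k A B C) (m : Idx k) :
    Sum.inl m ∈ (GkABC k A B C).neighborSet (Sum.inr q) ∩ Xset k A B C ↔ memN k A B C q m := by
  simp [GkABC, Xset, gAdjRel, memN]

theorem memN_inj (k A B C : ℕ) (q r : Quad k A B C)
    (h : ∀ m, memN k A B C q m ↔ memN k A B C r m) : q = r := by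
  have lo : ∀ (q : Quad k A B C) m, memN k A B C q m → (q.1.1 : ℕ) ≤ m := by
    rintro ⟨⟨i, j, t, Y⟩, h1, h2, h3, h4, h5, h6⟩ m hm
    have g1 : (i : ℕ) ≤ j := h1
    have g3 : (j : ℕ) + 2 ≤ t := h3
    have g6 : ∀ y ∈ Y, (t : ℕ) + 1 ≤ y ∧ (y : ℕ) ≤ t + C := h6
    have g1 : (i : ℕ) ≤ j := h1
    have g3 : (j : ℕ) + 2 ≤ t := h3
    have g6 : ∀ y ∈ Y, (t : ℕ) + 1 ≤ y ∧ (y : ℕ) ≤ t + C := h6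
    rcases hm with hm | hm | hm
    · exact hm.1
    · subst hm; dsimp at *; omega
    · have := g6 m hm; dsimp at *; omega
  have gap : ∀ (q : Quad k A B C) (m : Idx k), memN k A B C q m → (q.1.2.1 : ℕ) < m →
      (q.1.2.2.1 : ℕ) ≤ m := by
    rintro ⟨⟨i, j, t, Y⟩, h1, h2, h3, h4, h5, h6⟩ m hm hj
    have g1 : (i : ℕ) ≤ j := h1
    have g3 : (j : ℕ) + 2 ≤ t := h3
    have g6 : ∀ y ∈ Y, (t : ℕ) + 1 ≤ y ∧ (y : ℕ) ≤ t + C := h6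
    rcases hm with hm | hm | hm
    · dsimp at *; omega
    · subst hm; exact le_rfl
    · have := g6 m hm; dsimp at *; omega
  have last : ∀ (q : Quad k A B C) (m : Idx k), (q.1.2.2.1 : ℕ) < m →
      (memN k A B C q m ↔ m ∈ q.1.2.2.2) := by
    rintro ⟨⟨i, j, t, Y⟩, h1, h2, h3, h4, h5, h6⟩ m hm
    have g1 : (i : ℕ) ≤ j := h1
    have g3 : (j : ℕ) + 2 ≤ t := h3
    have g6 : ∀ y ∈ Y, (t : ℕ) + 1 ≤ y ∧ (y : ℕ) ≤ t + C := h6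
    constructor
    · rintro (h | h | h)
      · dsimp at *; omega
      · subst h; dsimp at *; omega
      · exact h
    · exact fun h => Or.inr (Or.inr h)
  have mi : ∀ q : Quad k A B C, memN k A B C q q.1.1 := fun q => Or.inl ⟨le_rfl, q.2.1⟩
  have mt : ∀ q : Quad k A B C, memN k A B C q q.1.2.2.1 := fun q => Or.inr (Or.inl rfl)
  have ei : (q.1.1 : ℕ) = r.1.1 :=
    le_antisymm (lo q _ ((h _).2 (mi r))) (lo r _ ((h _).1 (mi q)))
  have jle : ∀ q r : Quad k A B C, (∀ m, memN k A B C q m ↔ memN k A B C r m) →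
      (q.1.1 : ℕ) = r.1.1 → (r.1.2.1 : ℕ) ≤ q.1.2.1 := by
    intro q r h ei
    by_contra hlt
    have hr := r.1.2.1.2
    rw [Finset.mem_Icc] at hr
    have hq := q.2.1
    have hq3 := q.2.2.2.1
    have := gap q ⟨(q.1.2.1 : ℕ) + 1, by rw [Finset.mem_Icc]; omega⟩
      ((h _).2 (Or.inl ⟨by dsimp; omega, by dsimp; omega⟩)) (by dsimp; omega)
    dsimp at this
    omega
  have ej : (q.1.2.1 : ℕ) = r.1.2.1 :=
    le_antisymm (jle r q (fun m => (h m).symm) ei.symm) (jle q r h ei)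
  have hq3 := q.2.2.2.1
  have hr3 := r.2.2.2.1
  have et : (q.1.2.2.1 : ℕ) = r.1.2.2.1 :=
    le_antisymm (gap q _ ((h _).2 (mt r)) (by omega)) (gap r _ ((h _).1 (mt q)) (by omega))
  have eY : q.1.2.2.2 = r.1.2.2.2 := by
    ext m
    constructor
    · intro hm
      have := (q.2.2.2.2.2.2 m hm).1
      exact (last r m (by omega)).1 ((h m).1 ((last q m (by omega)).2 hm))
    · intro hm
      have := (r.2.2.2.2.2.2 m hm).1
      exact (last q m (by omega)).1 ((h m).2 ((last r m (by omega)).2 hm))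
  exact Subtype.ext (Prod.ext (Subtype.ext ei) (Prod.ext (Subtype.ext ej)
    (Prod.ext (Subtype.ext et) eY)))

theorem quad_card (k A B C : ℕ) :
    A * B * (k - A - B - C) * 2 ^ C ≤ Fintype.card (Quad k A B C) := by
  have key : ∀ p : ((Fin A × Fin B) × Fin (k - A - B - C)) × Finset (Fin C),
      ∃ q : Quad k A B C, (q.1.1 : ℕ) = p.1.2 + 1 ∧ (q.1.2.1 : ℕ) = p.1.2 + 1 + p.1.1.1 ∧
        (q.1.2.2.1 : ℕ) = p.1.2 + 1 + p.1.1.1 + 2 + p.1.1.2 ∧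
        ∀ c : Fin C, c ∈ p.2 ↔ ∃ y ∈ q.1.2.2.2, (y : ℕ) = q.1.2.2.1 + 1 + c := by
    rintro ⟨⟨⟨a, b⟩, i⟩, s⟩
    have ha := a.2
    have hb := b.2
    have hi := i.2
    refine ⟨⟨⟨⟨i + 1, by rw [Finset.mem_Icc]; omega⟩,
      ⟨i + 1 + a, by rw [Finset.mem_Icc]; omega⟩,
      ⟨i + 1 + a + 2 + b, by rw [Finset.mem_Icc]; omega⟩,
      s.image fun c : Fin C => ⟨i + 1 + a + 2 + b + 1 + c, by
        have := c.2
        rw [Finset.mem_Icc]; omega⟩⟩, ?_⟩, rfl, rfl, rfl, ?_⟩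
    · refine ⟨?_, ?_, ?_, ?_, ?_, ?_⟩
      any_goals (dsimp; omega)
      intro y hy
      obtain ⟨c, -, rfl⟩ := Finset.mem_image.1 hy
      have := c.2
      dsimp
      omega
    · intro c
      constructor
      · intro hc
        exact ⟨_, Finset.mem_image_of_mem _ hc, rfl⟩
      · rintro ⟨y, hy, e⟩
        obtain ⟨d, hd, rfl⟩ := Finset.mem_image.1 hy
        dsimp at e
        have : d = c := Fin.ext (by omega)
        exact this ▸ hd
  choose f h1 h2 h3 h4 using key
  have hf : Function.Injective f := by
    intro p p' e
    have a1 := h1 p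
    have a2 := h2 p
    have a3 := h3 p
    have b1 := h1 p'
    have b2 := h2 p'
    have b3 := h3 p'
    rw [e] at a1 a2 a3
    refine Prod.ext (Prod.ext (Prod.ext (Fin.ext ?_) (Fin.ext ?_)) (Fin.ext ?_)) ?_
    · omega
    · omega
    · omega
    · ext c
      rw [h4 p, h4 p', e]
  have := Fintype.card_le_of_injective f hf
  simpa using this

/-- If `k ≥ A + B + C`, then `G(k,A,B,C)` has at least `A·B·(k − A − B − C)·2^C` vertices
outside `X`, and hence at least that many distinct `X`-neighbourhoods. -/
theorem GkABC_many_neighbourhoods (k A B C : ℕ)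
    (hA : 0 < A) (hB : 0 < B) (hC : 0 < C) (hk : A + B + C ≤ k) :
    A * B * (k - A - B - C) * 2 ^ C ≤ Fintype.card (Quad k A B C) ∧
    A * B * (k - A - B - C) * 2 ^ C ≤
      {N : Set (GV k A B C) |
        ∃ v : GV k A B C, N = (GkABC k A B C).neighborSet v ∩ Xset k A B C}.ncard := by
  refine ⟨quad_card k A B C, (quad_card k A B C).trans ?_⟩
  let F : Quad k A B C → Set (GV k A B C) :=
    fun q => (GkABC k A B C).neighborSet (Sum.inr q) ∩ Xset k A B C
  have hF : Function.Injective F := by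
    intro q r e
    apply memN_inj
    intro m
    rw [← memN_iff, ← memN_iff]
    change _ ∈ F q ↔ _ ∈ F r
    rw [e]
  rw [← Nat.card_eq_fintype_card, ← Set.ncard_univ, ← Set.ncard_image_of_injective _ hF]
  apply Set.ncard_le_ncard
  · rintro _ ⟨q, -, rfl⟩
    exact ⟨Sum.inr q, rfl⟩
  · exact Set.toFinite _
end
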